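/- arXiv:2208.03830 — 2 statements merged into one kernel-verified Lean document; each statement's English description precedes it below -/
import Mathlib

section
/- Let b be a nonzero integer, R = Z[X]/(X^5 + 4*b^4*X - 1), and let θ be the class of X in R. Then θ is a unit of R with inverse θ^4 + 4*b^4, the element ξ_2 = θ^2 + 2*b*θ + 2*b^2 is a unit of R, and every unit u of R can be written uniquely as u = s · ξ_1^{n_1} · ξ_2^{n_2} with s ∈ {1, -1} and integers n_1, n_2, where ξ_1 = θ. -/
open Polynomial

/-- The polynomial `X^5 + 4*b^4*X - 1` over `ℤ`, so that `AdjoinRoot (thuePoly b)` is the ring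
`R = ℤ[X]/(X^5 + 4*b^4*X - 1)`. -/
noncomputable def thuePoly (b : ℤ) : ℤ[X] := X ^ 5 + C (4 * b ^ 4) * X - 1

open ComplexConjugate

/-- `t₀`, `t₁`, `t₂` represent the real root and the two pairs of complex conjugate roots of
`X^5 + 4*b^4*X - 1`. -/
structure ThueRoots (b : ℤ) (t₀ : ℝ) (t₁ t₂ : ℂ) : Prop where
  root₀ : (t₀ : ℂ) ^ 5 + 4 * (b : ℂ) ^ 4 * t₀ - 1 = 0
  root₁ : t₁ ^ 5 + 4 * (b : ℂ) ^ 4 * t₁ - 1 = 0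
  root₂ : t₂ ^ 5 + 4 * (b : ℂ) ^ 4 * t₂ - 1 = 0
  pos₀ : 0 < t₀
  im₁ : 0 < t₁.im
  im₂ : 0 < t₂.im
  re₁ : 0 < t₁.re
  re₂ : t₂.re < 0

/-- The five roots, listed. -/
noncomputable def thueNodes (t₀ : ℝ) (t₁ t₂ : ℂ) : Fin 5 → ℂ := ![t₀, t₁, conj t₁, t₂, conj t₂]

theorem thuePoly_monic (b : ℤ) : (thuePoly b).Monic := by
  unfold thuePoly; monicity!

theorem natDegree_thuePoly (b : ℤ) : (thuePoly b).natDegree = 5 := by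
  unfold thuePoly; compute_degree!

theorem eval₂_thuePoly (b : ℤ) (z : ℂ) :
    (thuePoly b).eval₂ (Int.castRingHom ℂ) z = z ^ 5 + 4 * (b : ℂ) ^ 4 * z - 1 := by
  simp only [thuePoly, eval₂_add, eval₂_sub, eval₂_mul, eval₂_pow, eval₂_X, eval₂_C, eval₂_one]
  simp

/-- Evaluation of elements of `R` at a complex root. -/
noncomputable def thueEval (b : ℤ) (z : ℂ) (hz : z ^ 5 + 4 * (b : ℂ) ^ 4 * z - 1 = 0) :
    AdjoinRoot (thuePoly b) →+* ℂ :=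
  AdjoinRoot.lift (Int.castRingHom ℂ) z (by rw [eval₂_thuePoly, hz])

theorem thueEval_mk (b : ℤ) (z : ℂ) (hz : z ^ 5 + 4 * (b : ℂ) ^ 4 * z - 1 = 0) (P : ℤ[X]) :
    thueEval b z hz (AdjoinRoot.mk _ P) = P.eval₂ (Int.castRingHom ℂ) z :=
  AdjoinRoot.lift_mk _ _

theorem thueEval_root (b : ℤ) (z : ℂ) (hz : z ^ 5 + 4 * (b : ℂ) ^ 4 * z - 1 = 0) :
    thueEval b z hz (AdjoinRoot.root _) = z :=
  AdjoinRoot.lift_root _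

namespace ThueRoots

variable {b : ℤ} {t₀ : ℝ} {t₁ t₂ : ℂ}

theorem conj_root {z : ℂ} (hz : z ^ 5 + 4 * (b : ℂ) ^ 4 * z - 1 = 0) :
    (conj z) ^ 5 + 4 * (b : ℂ) ^ 4 * conj z - 1 = 0 := by
  have := congrArg conj hz
  simpa [map_ofNat] using this

theorem nodes_injective (h : ThueRoots b t₀ t₁ t₂) :
    Function.Injective (thueNodes t₀ t₁ t₂) := by
  have key : ∀ {z w : ℂ}, z = w → z.re = w.re ∧ z.im = w.im := by
    rintro z _ rfl; exact ⟨rfl, rfl⟩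
  obtain ⟨_, _, _, h0, h1, h2, h3, h4⟩ := h
  intro i j hij
  fin_cases i <;> fin_cases j <;>
    first
    | rfl
    | (exfalso
       have := key hij
       simp [thueNodes] at this
       linarith)

theorem eval_nodes (h : ThueRoots b t₀ t₁ t₂) (i : Fin 5) :
    (thueNodes t₀ t₁ t₂ i) ^ 5 + 4 * (b : ℂ) ^ 4 * thueNodes t₀ t₁ t₂ i - 1 = 0 := by
  fin_cases i
  · exact h.root₀
  · exact h.root₁
  · exact conj_root h.root₁
  · exact h.root₂
  · exact conj_root h.root₂

theorem map_eq_nodal (h : ThueRoots b t₀ t₁ t₂) :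
    (thuePoly b).map (Int.castRingHom ℂ) = Lagrange.nodal Finset.univ (thueNodes t₀ t₁ t₂) := by
  have hm := (thuePoly_monic b).map (Int.castRingHom ℂ)
  have hd : ((thuePoly b).map (Int.castRingHom ℂ)).degree = 5 := by
    rw [(thuePoly_monic b).degree_map, degree_eq_natDegree (thuePoly_monic b).ne_zero,
      natDegree_thuePoly]; rfl
  apply eq_of_degree_le_of_eval_index_eq (s := Finset.univ) (v := thueNodes t₀ t₁ t₂) h.nodes_injective.injOn
  · rw [hd]; rfl
  · rw [hd, Lagrange.degree_nodal]; rfl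
  · rw [hm.leadingCoeff, Lagrange.nodal_monic.leadingCoeff]
  · intro i hi
    rw [Lagrange.eval_nodal_at_node hi, eval_map, eval₂_thuePoly, h.eval_nodes]

theorem eval_eq_prod (h : ThueRoots b t₀ t₁ t₂) (z : ℂ) :
    z ^ 5 + 4 * (b : ℂ) ^ 4 * z - 1 =
      (z - t₀) * ((z - t₁) * (z - conj t₁) * ((z - t₂) * (z - conj t₂))) := by
  rw [← eval₂_thuePoly, ← eval_map, h.map_eq_nodal, Lagrange.eval_nodal, Fin.prod_univ_five]
  simp [thueNodes]; ring

theorem eval₂_conj (P : ℤ[X]) (z : ℂ) :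
    P.eval₂ (Int.castRingHom ℂ) (conj z) = conj (P.eval₂ (Int.castRingHom ℂ) z) := by
  rw [hom_eval₂]; congr 1; ext; simp

theorem prod_eval₂_nodes (P : ℤ[X]) :
    ‖∏ i, P.eval₂ (Int.castRingHom ℂ) (thueNodes t₀ t₁ t₂ i)‖ =
      ‖P.eval₂ (Int.castRingHom ℂ) (t₀ : ℂ)‖ * ‖P.eval₂ (Int.castRingHom ℂ) t₁‖ ^ 2 *
        ‖P.eval₂ (Int.castRingHom ℂ) t₂‖ ^ 2 := by
  rw [Fin.prod_univ_five]
  change ‖P.eval₂ _ (t₀ : ℂ) * P.eval₂ _ t₁ * P.eval₂ _ (conj t₁) * P.eval₂ _ t₂ *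
    P.eval₂ _ (conj t₂)‖ = _
  simp only [eval₂_conj, norm_mul, Complex.norm_conj]; ring

theorem prod_eval₂_mem_int (h : ThueRoots b t₀ t₁ t₂) (P : ℤ[X]) :
    ∃ n : ℤ, ∏ i, P.eval₂ (Int.castRingHom ℂ) (thueNodes t₀ t₁ t₂ i) = n := by
  refine ⟨resultant (thuePoly b) P, ?_⟩
  have h1 := resultant_eq_prod_eval ((thuePoly b).map (Int.castRingHom ℂ))
    (P.map (Int.castRingHom ℂ)) P.natDegree natDegree_map_le (IsAlgClosed.splits _)
  rw [(thuePoly_monic b).natDegree_map, resultant_map_map,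
    ((thuePoly_monic b).map _).leadingCoeff, one_pow, one_mul, h.map_eq_nodal] at h1
  have h2 : (Lagrange.nodal Finset.univ (thueNodes t₀ t₁ t₂)).roots =
      Finset.univ.val.map (thueNodes t₀ t₁ t₂) := by
    rw [Lagrange.nodal, roots_prod _ _ (Finset.prod_ne_zero_iff.2 fun i _ => X_sub_C_ne_zero _)]
    simp
  rw [h2, Multiset.map_map] at h1
  rw [← eq_intCast (Int.castRingHom ℂ), h1]
  simp [Finset.prod, eval_map]

theorem norm_unit (h : ThueRoots b t₀ t₁ t₂) (u : (AdjoinRoot (thuePoly b))ˣ) :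
    ‖thueEval b t₀ h.root₀ u‖ * ‖thueEval b t₁ h.root₁ u‖ ^ 2 * ‖thueEval b t₂ h.root₂ u‖ ^ 2
      = 1 := by
  obtain ⟨P, hP⟩ := AdjoinRoot.mk_surjective (u : AdjoinRoot (thuePoly b))
  obtain ⟨Q, hQ⟩ := AdjoinRoot.mk_surjective ((u⁻¹ : _ˣ) : AdjoinRoot (thuePoly b))
  obtain ⟨m, hm⟩ := h.prod_eval₂_mem_int P
  obtain ⟨n, hn⟩ := h.prod_eval₂_mem_int Q
  have hmn : m * n = 1 := by
    have : (m * n : ℂ) = 1 := by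
      rw [← hm, ← hn, ← Finset.prod_mul_distrib]
      refine Finset.prod_eq_one fun i _ => ?_
      rw [← thueEval_mk b _ (h.eval_nodes i), ← thueEval_mk b _ (h.eval_nodes i), hP, hQ, ← map_mul]
      simp
    exact_mod_cast this
  have h3 := prod_eval₂_nodes (t₀ := t₀) (t₁ := t₁) (t₂ := t₂) P
  rw [hm] at h3
  rw [← hP, thueEval_mk, thueEval_mk, thueEval_mk, ← h3]
  rcases Int.isUnit_iff.1 (IsUnit.of_mul_eq_one _ hmn) with rfl | rfl <;> simp

/-- The derivative `5*z^4 + 4*b^4` gives the weights in Lagrange interpolation. -/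
theorem coeff_eq_sum (h : ThueRoots b t₀ t₁ t₂) {P : ℤ[X]} (hP : P.natDegree < 5) :
    (P.coeff 4 : ℂ) = ∑ i, P.eval₂ (Int.castRingHom ℂ) (thueNodes t₀ t₁ t₂ i) /
      (5 * thueNodes t₀ t₁ t₂ i ^ 4 + 4 * (b : ℂ) ^ 4) := by
  have hd : (P.map (Int.castRingHom ℂ)).degree < (Finset.univ : Finset (Fin 5)).card :=
    lt_of_le_of_lt degree_map_le (by
      refine lt_of_le_of_lt degree_le_natDegree ?_
      simpa using hP)
  have h1 := Lagrange.coeff_eq_sum (s := Finset.univ) h.nodes_injective.injOn hd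
  simp only [Finset.card_univ, Fintype.card_fin, coeff_map] at h1
  norm_num at h1
  rw [h1]
  refine Finset.sum_congr rfl fun i hi => ?_
  rw [eval_map]
  congr 1
  have h2 := Lagrange.eval_nodal_derivative_eval_node_eq (v := thueNodes t₀ t₁ t₂) hi
  rw [Lagrange.eval_nodal, ← h.map_eq_nodal] at h2
  rw [← h2, derivative_map, eval_map]
  simp only [thuePoly, derivative_sub, derivative_add, derivative_X_pow, derivative_C_mul,
    derivative_X, derivative_one, eval₂_add, eval₂_sub, eval₂_mul, eval₂_pow, eval₂_X, eval₂_C,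
    eval₂_one, eval₂_zero]
  simp

theorem coeff_bound (h : ThueRoots b t₀ t₁ t₂) {P : ℤ[X]} (hP : P.natDegree < 5) :
    |(P.coeff 4 : ℝ)| ≤
      ‖P.eval₂ (Int.castRingHom ℂ) (t₀ : ℂ)‖ / ‖5 * (t₀ : ℂ) ^ 4 + 4 * (b : ℂ) ^ 4‖ +
      2 * (‖P.eval₂ (Int.castRingHom ℂ) t₁‖ / ‖5 * t₁ ^ 4 + 4 * (b : ℂ) ^ 4‖) +
      2 * (‖P.eval₂ (Int.castRingHom ℂ) t₂‖ / ‖5 * t₂ ^ 4 + 4 * (b : ℂ) ^ 4‖) := by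
  have h1 := congrArg norm (h.coeff_eq_sum hP)
  have hc : ∀ z : ℂ, ‖5 * (conj z) ^ 4 + 4 * (b : ℂ) ^ 4‖ = ‖5 * z ^ 4 + 4 * (b : ℂ) ^ 4‖ := by
    intro z
    rw [← Complex.norm_conj (5 * z ^ 4 + 4 * (b : ℂ) ^ 4)]; simp [map_ofNat]
  have h2 : ‖(P.coeff 4 : ℂ)‖ = |(P.coeff 4 : ℝ)| := by
    rw [Complex.norm_intCast]
  rw [← h2, h1]
  refine (norm_sum_le _ _).trans (le_of_eq ?_)
  rw [Fin.sum_univ_five]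
  change ‖P.eval₂ _ (t₀ : ℂ) / (5 * (t₀ : ℂ) ^ 4 + 4 * (b : ℂ) ^ 4)‖ +
    ‖P.eval₂ _ t₁ / (5 * t₁ ^ 4 + 4 * (b : ℂ) ^ 4)‖ +
    ‖P.eval₂ _ (conj t₁) / (5 * (conj t₁) ^ 4 + 4 * (b : ℂ) ^ 4)‖ +
    ‖P.eval₂ _ t₂ / (5 * t₂ ^ 4 + 4 * (b : ℂ) ^ 4)‖ +
    ‖P.eval₂ _ (conj t₂) / (5 * (conj t₂) ^ 4 + 4 * (b : ℂ) ^ 4)‖ = _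
  simp only [eval₂_conj, norm_div, Complex.norm_conj, hc]
  ring

end ThueRoots

theorem int_binomial_norm_eq_one {b c d : ℤ} (hb : 1 ≤ b) (hd : |d| < 2 * b)
    (h : |c ^ 5 + 4 * b ^ 4 * c * d ^ 4 + d ^ 5| = 1) :
    (|c| = 1 ∧ d = 0) ∨ (c = 0 ∧ |d| = 1) := by
  have hpow : ∀ x : ℤ, |x ^ 5| = 1 → |x| = 1 := by
    intro x hx
    rw [abs_pow] at hx
    exact (pow_eq_one_iff_of_nonneg (abs_nonneg x) (by norm_num)).1 hx
  rcases eq_or_ne d 0 with rfl | hd0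
  · exact Or.inl ⟨hpow c (by simpa using h), rfl⟩
  rcases eq_or_ne c 0 with rfl | hc0
  · exact Or.inr ⟨rfl, hpow d (by simpa using h)⟩
  exfalso
  have hc1 := Int.one_le_abs hc0
  have hd1 := Int.one_le_abs hd0
  have h1 : |c| * (|c| ^ 4 + 4 * b ^ 4 * |d| ^ 4) ≤ 1 + |d| ^ 5 := by
    have e1 : |c| * (|c| ^ 4 + 4 * b ^ 4 * |d| ^ 4) = |c ^ 5 + 4 * b ^ 4 * c * d ^ 4| := by
      rw [(by decide : Even 4).pow_abs, (by decide : Even 4).pow_abs,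
        ← abs_of_nonneg (show (0 : ℤ) ≤ c ^ 4 + 4 * b ^ 4 * d ^ 4 by positivity), ← abs_mul]
      ring_nf
    rw [e1, ← abs_pow, ← h]
    have := abs_sub (c ^ 5 + 4 * b ^ 4 * c * d ^ 4 + d ^ 5) (d ^ 5)
    simpa using this
  have h2 : (1 : ℤ) ≤ |c| ^ 4 := one_le_pow₀ hc1
  have hb4 : b ≤ b ^ 4 := le_self_pow₀ hb (by norm_num)
  have h3 : |d| * |d| ^ 4 < 4 * b ^ 4 * |d| ^ 4 :=
    mul_lt_mul_of_pos_right (by linarith) (by positivity)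
  have h4 : 1 * (|c| ^ 4 + 4 * b ^ 4 * |d| ^ 4) ≤ |c| * (|c| ^ 4 + 4 * b ^ 4 * |d| ^ 4) :=
    mul_le_mul_of_nonneg_right hc1 (by positivity)
  nlinarith

namespace ThueRoots

variable {b : ℤ} {t₀ : ℝ} {t₁ t₂ : ℂ}

theorem coeff_bound_of_natDegree_add_le (h : ThueRoots b t₀ t₁ t₂) {P : ℤ[X]} (k : ℕ)
    (hk : k ≤ 4) (hP : P.natDegree + k ≤ 4) :
    |(P.coeff (4 - k) : ℝ)| ≤
      ‖P.eval₂ (Int.castRingHom ℂ) (t₀ : ℂ)‖ / ‖5 * (t₀ : ℂ) ^ 4 + 4 * (b : ℂ) ^ 4‖ * t₀ ^ k +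
      2 * (‖P.eval₂ (Int.castRingHom ℂ) t₁‖ / ‖5 * t₁ ^ 4 + 4 * (b : ℂ) ^ 4‖) * ‖t₁‖ ^ k +
      2 * (‖P.eval₂ (Int.castRingHom ℂ) t₂‖ / ‖5 * t₂ ^ 4 + 4 * (b : ℂ) ^ 4‖) * ‖t₂‖ ^ k := by
  have hd : (X ^ k * P).natDegree < 5 := by
    have := natDegree_mul_le (p := X ^ k) (q := P)
    rw [natDegree_X_pow] at this
    omega
  have h1 := h.coeff_bound hd
  rw [coeff_X_pow_mul', if_pos hk] at h1
  refine h1.trans (le_of_eq ?_)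
  have h0 : ‖(t₀ : ℂ)‖ = t₀ := by simp [abs_of_pos h.pos₀]
  simp only [eval₂_mul, eval₂_pow, eval₂_X, norm_mul, norm_pow, h0]
  ring

theorem eq_one_or_root_of_small (h : ThueRoots b t₀ t₁ t₂) (hb : 1 ≤ b)
    (ht₀ : t₀ ≤ 2 * b) (ht₁ : ‖t₁‖ ≤ 2 * b) (ht₂ : ‖t₂‖ ≤ 2 * b) (u : (AdjoinRoot (thuePoly b))ˣ)
    (h4 : ‖thueEval b t₀ h.root₀ u‖ / ‖5 * (t₀ : ℂ) ^ 4 + 4 * (b : ℂ) ^ 4‖ +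
      2 * (‖thueEval b t₁ h.root₁ u‖ / ‖5 * t₁ ^ 4 + 4 * (b : ℂ) ^ 4‖) +
      2 * (‖thueEval b t₂ h.root₂ u‖ / ‖5 * t₂ ^ 4 + 4 * (b : ℂ) ^ 4‖) < 1)
    (h2 : ‖thueEval b t₀ h.root₀ u‖ / ‖5 * (t₀ : ℂ) ^ 4 + 4 * (b : ℂ) ^ 4‖ * t₀ ^ 2 +
      2 * (‖thueEval b t₁ h.root₁ u‖ / ‖5 * t₁ ^ 4 + 4 * (b : ℂ) ^ 4‖) * ‖t₁‖ ^ 2 +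
      2 * (‖thueEval b t₂ h.root₂ u‖ / ‖5 * t₂ ^ 4 + 4 * (b : ℂ) ^ 4‖) * ‖t₂‖ ^ 2 < 1) :
    ∃ s : ℤˣ, (u : AdjoinRoot (thuePoly b)) = ((s : ℤ) : AdjoinRoot (thuePoly b)) ∨
      (u : AdjoinRoot (thuePoly b)) =
        ((s : ℤ) : AdjoinRoot (thuePoly b)) * AdjoinRoot.root (thuePoly b) := by
  obtain ⟨P, hPd, hP⟩ : ∃ P : ℤ[X], P.natDegree ≤ 4 ∧
      AdjoinRoot.mk (thuePoly b) P = (u : AdjoinRoot (thuePoly b)) := by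
    obtain ⟨Q, hQ⟩ := AdjoinRoot.mk_surjective (u : AdjoinRoot (thuePoly b))
    refine ⟨Q %ₘ thuePoly b, ?_, ?_⟩
    · have := natDegree_modByMonic_lt Q (thuePoly_monic b) (fun h => by
        have := natDegree_thuePoly b; rw [h] at this; simp at this)
      rw [natDegree_thuePoly] at this; omega
    · rw [← hQ]
      nth_rewrite 2 [← modByMonic_add_div Q (thuePoly b)]
      rw [map_add, map_mul, AdjoinRoot.mk_self, zero_mul, add_zero]
  have hN := h.norm_unit u
  rw [← hP] at h4 h2 hN
  simp only [thueEval_mk] at h4 h2 hN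
  have eq_zero_of_lt : ∀ {c : ℤ}, |(c : ℝ)| < 1 → c = 0 := by
    intro c hc
    exact Int.abs_lt_one_iff.1 (by exact_mod_cast hc)
  have hbd := fun k hk hPk => h.coeff_bound_of_natDegree_add_le (P := P) k hk hPk
  set B₀ := ‖P.eval₂ (Int.castRingHom ℂ) (t₀ : ℂ)‖ / ‖5 * (t₀ : ℂ) ^ 4 + 4 * (b : ℂ) ^ 4‖
  set B₁ := ‖P.eval₂ (Int.castRingHom ℂ) t₁‖ / ‖5 * t₁ ^ 4 + 4 * (b : ℂ) ^ 4‖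
  set B₂ := ‖P.eval₂ (Int.castRingHom ℂ) t₂‖ / ‖5 * t₂ ^ 4 + 4 * (b : ℂ) ^ 4‖
  have hB₀ : 0 ≤ B₀ := by positivity
  have hB₁ : 0 ≤ B₁ := by positivity
  have hB₂ : 0 ≤ B₂ := by positivity
  have e4 : P.coeff 4 = 0 := eq_zero_of_lt (by
    have := hbd 0 (by norm_num) (by omega)
    simp only [pow_zero, mul_one] at this
    exact this.trans_lt h4)
  have hP3 := natDegree_le_pred hPd e4
  have e3 : P.coeff 3 = 0 := eq_zero_of_lt (by
    refine (hbd 1 (by norm_num) (by omega)).trans_lt ?_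
    simp only [pow_one]
    have i₀ := mul_le_mul_of_nonneg_left (show 2 * t₀ ≤ 1 + t₀ ^ 2 by nlinarith [sq_nonneg (t₀ - 1)]) hB₀
    have i₁ := mul_le_mul_of_nonneg_left
      (show 2 * ‖t₁‖ ≤ 1 + ‖t₁‖ ^ 2 by nlinarith [sq_nonneg (‖t₁‖ - 1)]) hB₁
    have i₂ := mul_le_mul_of_nonneg_left
      (show 2 * ‖t₂‖ ≤ 1 + ‖t₂‖ ^ 2 by nlinarith [sq_nonneg (‖t₂‖ - 1)]) hB₂
    linarith)
  have hP2 := natDegree_le_pred hP3 e3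
  have e2 : P.coeff 2 = 0 := eq_zero_of_lt ((hbd 2 (by norm_num) (by omega)).trans_lt h2)
  have hP1 := natDegree_le_pred hP2 e2
  have e1 : |P.coeff 1| < 2 * b := by
    have hb' : (0 : ℝ) < 2 * b := by
      have : (1 : ℝ) ≤ b := by exact_mod_cast hb
      linarith
    have : |(P.coeff 1 : ℝ)| < 2 * b := by
      refine (hbd 3 (by norm_num) (by omega)).trans_lt ?_
      have i₀ := mul_le_mul_of_nonneg_left ht₀ (mul_nonneg hB₀ (sq_nonneg t₀))
      have i₁ := mul_le_mul_of_nonneg_left ht₁ (mul_nonneg hB₁ (sq_nonneg ‖t₁‖))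
      have i₂ := mul_le_mul_of_nonneg_left ht₂ (mul_nonneg hB₂ (sq_nonneg ‖t₂‖))
      have := mul_lt_mul_of_pos_right h2 hb'
      linarith
    exact_mod_cast this
  obtain ⟨d, c, hdc⟩ := exists_eq_X_add_C_of_natDegree_le_one hP1
  have hd : P.coeff 1 = d := by
    rw [hdc, coeff_add, coeff_C_mul, coeff_X_one, coeff_C_succ, mul_one, add_zero]
  rw [hd] at e1
  have hev : ∀ z : ℂ, P.eval₂ (Int.castRingHom ℂ) z = d * z + c := by
    intro z; rw [hdc]; simp only [eval₂_add, eval₂_mul, eval₂_C, eval₂_X]; simp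
  have hN' : |c ^ 5 + 4 * b ^ 4 * c * d ^ 4 + d ^ 5| = 1 := by
    simp only [hev] at hN
    have hprod : ((c : ℂ) ^ 5 + 4 * b ^ 4 * c * d ^ 4 + d ^ 5) =
        (d * t₀ + c) * ((d * t₁ + c) * (conj (d * t₁ + c)) *
          ((d * t₂ + c) * (conj (d * t₂ + c)))) := by
      rcases eq_or_ne d 0 with rfl | hd0
      · simp; ring
      · have hd0 : (d : ℂ) ≠ 0 := by exact_mod_cast hd0
        have := h.eval_eq_prod (-(c / d))
        have h5 : (d : ℂ) ^ 5 * ((-(c / d : ℂ)) ^ 5 + 4 * (b : ℂ) ^ 4 * (-(c / d)) - 1) =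
            -((c : ℂ) ^ 5 + 4 * b ^ 4 * c * d ^ 4 + d ^ 5) := by
          field_simp; ring
        rw [this] at h5
        rw [← neg_eq_iff_eq_neg] at h5
        rw [← h5]
        simp only [map_add, map_mul, map_intCast]
        field_simp
        ring
    have := congrArg norm hprod
    simp only [norm_mul, Complex.norm_conj] at this
    have h6 : ‖(c : ℂ) ^ 5 + 4 * b ^ 4 * c * d ^ 4 + d ^ 5‖ = 1 := by
      rw [this, ← hN]; ring
    have h7 : ((c : ℂ) ^ 5 + 4 * b ^ 4 * c * d ^ 4 + d ^ 5) =
        ((c ^ 5 + 4 * b ^ 4 * c * d ^ 4 + d ^ 5 : ℤ) : ℂ) := by push_cast; ring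
    rw [h7, Complex.norm_intCast] at h6
    exact_mod_cast h6
  have hu : ∀ x : ℤ, |x| = 1 → ∃ s : ℤˣ, (s : ℤ) = x := fun x hx => by
    obtain ⟨s, hs⟩ := Int.isUnit_iff.2 (eq_or_eq_neg_of_abs_eq hx)
    exact ⟨s, hs⟩
  rcases int_binomial_norm_eq_one hb e1 hN' with ⟨h1, rfl⟩ | ⟨rfl, h1⟩
  · obtain ⟨s, rfl⟩ := hu c h1
    refine ⟨s, Or.inl ?_⟩
    rw [← hP, hdc]; simp
  · obtain ⟨s, rfl⟩ := hu d h1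
    refine ⟨s, Or.inr ?_⟩
    rw [← hP, hdc]; simp

end ThueRoots

theorem exists_log_reduction {τ₀ τ₁ τ₂ σ₀ σ₁ σ₂ L₀ L₁ L₂ k ρ₁ ρ₂ y₀ : ℝ}
    (hτ : τ₀ + 2 * τ₁ + 2 * τ₂ = 0) (hσ : σ₀ + 2 * σ₁ + 2 * σ₂ = 0)
    (hL : L₀ + 2 * L₁ + 2 * L₂ = 0) (hτ₀ : τ₀ < 0) (hτ₁ : 0 < τ₁) (hτ₂ : 0 < τ₂) (hσ₀ : 0 ≤ σ₀) (hσ₁ : 0 < σ₁)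
    (hρ₁ : τ₁ ≤ ρ₁ * -τ₀) (hρ₂ : τ₂ ≤ ρ₂ * -τ₀) (hk : k + τ₀ ≤ 0)
    (hy₀ : 0 ≤ y₀) (hy₁ : y₀ ≤ 1) :
    ∃ (n m : ℤ) (w : ℝ), -(y₀ * (σ₁ + ρ₁ * σ₀)) ≤ w ∧ w ≤ (1 - y₀) * (σ₁ + ρ₁ * σ₀) ∧
      L₀ + n * τ₀ + m * σ₀ ≤ k ∧ L₁ + n * τ₁ + m * σ₁ ≤ ρ₁ * -(k + τ₀) + w ∧
      L₂ + n * τ₂ + m * σ₂ ≤ ρ₂ * -(k + τ₀) - w := by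
  obtain ⟨r, hr⟩ : ∃ r, r = τ₁ / -τ₀ := ⟨_, rfl⟩
  have hτ₀' : 0 < -τ₀ := neg_pos.2 hτ₀
  have hr0 : 0 < r := hr ▸ div_pos hτ₁ hτ₀'
  have hrτ : τ₁ = -(r * τ₀) := by
    have : r * -τ₀ = τ₁ := hr ▸ div_mul_cancel₀ _ hτ₀'.ne'
    linarith
  have hr1 : r ≤ ρ₁ := by rw [hr, div_le_iff₀ hτ₀']; exact hρ₁
  have hr2 : 1 / 2 - r ≤ ρ₂ := by
    refine le_of_mul_le_mul_right ?_ hτ₀'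
    linarith
  obtain ⟨e, he⟩ : ∃ e, e = σ₁ + r * σ₀ := ⟨_, rfl⟩
  have he0 : 0 < e := by rw [he]; positivity
  have he1 : e ≤ σ₁ + ρ₁ * σ₀ := by rw [he]; gcongr
  obtain ⟨q, hq⟩ : ∃ q, q = (L₁ + r * L₀) / e := ⟨_, rfl⟩
  have hqe : q * e = L₁ + r * L₀ := by rw [hq]; field_simp
  obtain ⟨m, hm⟩ : ∃ m : ℤ, m = -⌊q + y₀⌋ := ⟨_, rfl⟩
  have hm1 : -y₀ ≤ q + m := by
    have := Int.floor_le (q + y₀)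
    rw [hm]; push_cast; linarith
  have hm2 : q + m ≤ 1 - y₀ := by
    have := Int.lt_floor_add_one (q + y₀)
    rw [hm]; push_cast; linarith
  obtain ⟨z, hz⟩ : ∃ z, z = (L₀ + m * σ₀ - k) / -τ₀ := ⟨_, rfl⟩
  have hzτ : z * -τ₀ = L₀ + m * σ₀ - k := hz ▸ div_mul_cancel₀ _ hτ₀'.ne'
  have hn1 : z * -τ₀ ≤ ⌈z⌉ * -τ₀ := by gcongr; exact Int.le_ceil z
  have hn2 : ⌈z⌉ * -τ₀ ≤ (z + 1) * -τ₀ := by gcongr; exact (Int.ceil_lt_add_one z).le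
  have hw : L₁ + ⌈z⌉ * τ₁ + m * σ₁ + r * (L₀ + ⌈z⌉ * τ₀ + m * σ₀) = (q + m) * e := by
    rw [add_mul, hqe, he, hrτ]; ring
  have hlow : k + τ₀ ≤ L₀ + ⌈z⌉ * τ₀ + m * σ₀ := by linarith
  have hsum : L₂ + ⌈z⌉ * τ₂ + m * σ₂ =
      -(1 / 2) * (L₀ + ⌈z⌉ * τ₀ + m * σ₀) - (L₁ + ⌈z⌉ * τ₁ + m * σ₁) := by
    rw [show L₂ = -(1 / 2) * L₀ - L₁ by linarith, show τ₂ = -(1 / 2) * τ₀ - τ₁ by linarith,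
      show σ₂ = -(1 / 2) * σ₀ - σ₁ by linarith]
    ring
  have hrk : r * -(k + τ₀) ≤ ρ₁ * -(k + τ₀) := mul_le_mul_of_nonneg_right hr1 (by linarith)
  have hrk2 : (1 / 2 - r) * -(k + τ₀) ≤ ρ₂ * -(k + τ₀) :=
    mul_le_mul_of_nonneg_right hr2 (by linarith)
  have hr2' : 0 ≤ 1 / 2 - r := by
    refine le_of_mul_le_mul_right ?_ hτ₀'
    linarith
  have hl1 := mul_le_mul_of_nonneg_left hlow hr0.le
  have hl2 := mul_le_mul_of_nonneg_left hlow hr2'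
  have hw1 : -(y₀ * (σ₁ + ρ₁ * σ₀)) ≤ (q + m) * e := by
    have i1 := mul_le_mul_of_nonneg_left he1 hy₀
    have i2 := mul_le_mul_of_nonneg_right hm1 he0.le
    linarith
  have hw2 : (q + m) * e ≤ (1 - y₀) * (σ₁ + ρ₁ * σ₀) := by
    have i1 := mul_le_mul_of_nonneg_left he1 (sub_nonneg.2 hy₁)
    have i2 := mul_le_mul_of_nonneg_right hm2 he0.le
    linarith
  refine ⟨⌈z⌉, m, (q + m) * e, hw1, hw2, by linarith, by linarith, by linarith⟩

theorem exists_zpow_reduction {a₀ a₁ a₂ x₀ x₁ x₂ A₀ A₁ A₂ K ρ₁ ρ₂ y₀ α β l g : ℝ}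
    (ha₀ : 0 < a₀) (ha₀' : a₀ < 1) (ha₁ : 1 < a₁) (ha₂ : 1 < a₂)
    (hx₀ : 1 ≤ x₀) (hx₁ : 1 < x₁) (hx₂ : 0 < x₂) (hA₀ : 0 < A₀) (hA₁ : 0 < A₁) (hA₂ : 0 < A₂)
    (ha : a₀ * a₁ ^ 2 * a₂ ^ 2 = 1) (hx : x₀ * x₁ ^ 2 * x₂ ^ 2 = 1)
    (hA : A₀ * A₁ ^ 2 * A₂ ^ 2 = 1) (hK : 0 < K) (hKa : K * a₀ ≤ 1)
    (hρ₁ : Real.log a₁ ≤ ρ₁ * -Real.log a₀) (hρ₂ : Real.log a₂ ≤ ρ₂ * -Real.log a₀)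
    (hy₀ : 0 ≤ y₀) (hy₁ : y₀ ≤ 1) (hα : 0 < α) (hβ : 0 < β) (hl : 0 < l) (hg : 0 < g)
    (hKα : ρ₁ * -Real.log (K * a₀) ≤ Real.log α) (hKβ : ρ₂ * -Real.log (K * a₀) ≤ Real.log β)
    (hEl : y₀ * (Real.log x₁ + ρ₁ * Real.log x₀) ≤ -Real.log l)
    (hEg : (1 - y₀) * (Real.log x₁ + ρ₁ * Real.log x₀) ≤ Real.log g) :
    ∃ (n m : ℤ) (v : ℝ), l ≤ v ∧ v ≤ g ∧ A₀ * (a₀ ^ n * x₀ ^ m) ≤ K ∧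
      A₁ * (a₁ ^ n * x₁ ^ m) ≤ α * v ∧ A₂ * (a₂ ^ n * x₂ ^ m) ≤ β / v := by
  have hlog : ∀ {p q r : ℝ}, 0 < p → 0 < q → 0 < r → p * q ^ 2 * r ^ 2 = 1 →
      Real.log p + 2 * Real.log q + 2 * Real.log r = 0 := by
    intro p q r hp hq hr h
    have := congrArg Real.log h
    rw [Real.log_mul (by positivity) (by positivity), Real.log_mul (by positivity) (by positivity),
      Real.log_pow, Real.log_pow, Real.log_one] at this
    exact_mod_cast this
  have ha₁0 : 0 < a₁ := by linarith
  have ha₂0 : 0 < a₂ := by linarith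
  have hx₀0 : 0 < x₀ := by linarith
  have hx₁0 : 0 < x₁ := by linarith
  have hKlog : Real.log (K * a₀) = Real.log K + Real.log a₀ := Real.log_mul hK.ne' ha₀.ne'
  rw [hKlog] at hKα hKβ
  obtain ⟨n, m, w, hw₁, hw₂, h₀, h₁, h₂⟩ := exists_log_reduction (hlog ha₀ ha₁0 ha₂0 ha)
    (hlog hx₀0 hx₁0 hx₂ hx) (hlog hA₀ hA₁ hA₂ hA) (Real.log_neg ha₀ ha₀') (Real.log_pos ha₁)
    (Real.log_pos ha₂) (Real.log_nonneg hx₀) (Real.log_pos hx₁) hρ₁ hρ₂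
    (hKlog ▸ Real.log_nonpos (by positivity) hKa) hy₀ hy₁
  have hmul : ∀ {p q r : ℝ}, 0 < p → 0 < q → 0 < r →
      Real.log (p * (q ^ n * r ^ m)) = Real.log p + n * Real.log q + m * Real.log r := by
    intro p q r hp hq hr
    rw [Real.log_mul (by positivity) (by positivity), Real.log_mul (by positivity) (by positivity),
      Real.log_zpow, Real.log_zpow, add_assoc]
  refine ⟨n, m, Real.exp w, ?_, ?_, ?_, ?_, ?_⟩
  · rw [← Real.log_le_iff_le_exp hl]; linarith
  · rw [← Real.le_log_iff_exp_le hg]; linarith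
  · rw [← Real.log_le_log_iff (by positivity) hK, hmul hA₀ ha₀ hx₀0]; exact h₀
  · rw [← Real.log_le_log_iff (by positivity) (by positivity), hmul hA₁ ha₁0 hx₁0,
      Real.log_mul hα.ne' (Real.exp_pos _).ne', Real.log_exp]
    linarith
  · rw [← Real.log_le_log_iff (by positivity) (by positivity), hmul hA₂ ha₂0 hx₂,
      Real.log_div hβ.ne' (Real.exp_pos _).ne', Real.log_exp]
    linarith

theorem add_mul_add_div_lt_one {p q s l g v : ℝ} (hs : 0 ≤ s) (hl : 0 < l)
    (hlv : l ≤ v) (hvg : v ≤ g) (h₁ : p + q * l + s / l < 1) (h₂ : p + q * g + s / g < 1) :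
    p + q * v + s / v < 1 := by
  have hv : 0 < v := by linarith
  have hg : 0 < g := by linarith
  rcases eq_or_lt_of_le (hlv.trans hvg) with h | h
  · obtain rfl : v = l := by linarith
    exact h₁
  have h3 : s / v ≤ s * ((l + g - v) / (l * g)) := by
    rw [div_eq_mul_inv]
    refine mul_le_mul_of_nonneg_left ?_ hs
    rw [inv_eq_one_div, div_le_div_iff₀ hv (by positivity)]
    nlinarith [mul_nonneg (sub_nonneg.2 hlv) (sub_nonneg.2 hvg)]
  have h4 : (g - l) * (p + q * v + s * ((l + g - v) / (l * g))) =
      (g - v) * (p + q * l + s / l) + (v - l) * (p + q * g + s / g) := by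
    field_simp; ring
  have h5 : (g - v) * (p + q * l + s / l) + (v - l) * (p + q * g + s / g) < g - l := by
    rcases eq_or_lt_of_le hvg with h6 | h6
    · subst h6
      nlinarith
    · nlinarith [mul_lt_mul_of_pos_left h₁ (sub_pos.2 h6),
        mul_le_mul_of_nonneg_left h₂.le (sub_nonneg.2 hlv)]
  nlinarith

theorem thuePoly_root_mul (b : ℤ) :
    AdjoinRoot.root (thuePoly b) *
      ((AdjoinRoot.root (thuePoly b)) ^ 4 + 4 * (b : AdjoinRoot (thuePoly b)) ^ 4) = 1 := by
  have h : AdjoinRoot.mk (thuePoly b) (X ^ 5 + C (4 * b ^ 4) * X - 1) = 0 := AdjoinRoot.mk_self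
  rw [map_sub, map_add, map_mul, map_pow, AdjoinRoot.mk_X, AdjoinRoot.mk_C, map_one, map_mul,
    map_pow, map_ofNat, eq_intCast] at h
  linear_combination h

/-- The unit `θ` of `R`. -/
noncomputable def thueUnit₁ (b : ℤ) : (AdjoinRoot (thuePoly b))ˣ :=
  Units.mkOfMulEqOne _ _ (thuePoly_root_mul b)

theorem thuePoly_aurifeuille (b : ℤ) :
    ((AdjoinRoot.root (thuePoly b)) ^ 2 +
        2 * (b : AdjoinRoot (thuePoly b)) * AdjoinRoot.root (thuePoly b) +
        2 * (b : AdjoinRoot (thuePoly b)) ^ 2) *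
      (AdjoinRoot.root (thuePoly b) * ((AdjoinRoot.root (thuePoly b)) ^ 2 -
        2 * (b : AdjoinRoot (thuePoly b)) * AdjoinRoot.root (thuePoly b) +
        2 * (b : AdjoinRoot (thuePoly b)) ^ 2)) = 1 := by
  linear_combination thuePoly_root_mul b

/-- The unit `θ^2 + 2*b*θ + 2*b^2` of `R`. -/
noncomputable def thueUnit₂ (b : ℤ) : (AdjoinRoot (thuePoly b))ˣ :=
  Units.mkOfMulEqOne _ _ (thuePoly_aurifeuille b)

theorem coe_thueUnit₁ (b : ℤ) :
    (thueUnit₁ b : AdjoinRoot (thuePoly b)) = AdjoinRoot.root (thuePoly b) := rfl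

theorem coe_thueUnit₂ (b : ℤ) : (thueUnit₂ b : AdjoinRoot (thuePoly b)) =
    (AdjoinRoot.root (thuePoly b)) ^ 2 +
      2 * (b : AdjoinRoot (thuePoly b)) * AdjoinRoot.root (thuePoly b) +
      2 * (b : AdjoinRoot (thuePoly b)) ^ 2 := rfl

theorem thueEval_thueUnit₁ (b : ℤ) (z : ℂ) (hz : z ^ 5 + 4 * (b : ℂ) ^ 4 * z - 1 = 0) :
    thueEval b z hz (thueUnit₁ b) = z := thueEval_root b z hz

theorem thueEval_thueUnit₂ (b : ℤ) (z : ℂ) (hz : z ^ 5 + 4 * (b : ℂ) ^ 4 * z - 1 = 0) :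
    thueEval b z hz (thueUnit₂ b) = z ^ 2 + 2 * b * z + 2 * b ^ 2 := by
  rw [coe_thueUnit₂]
  simp only [map_add, map_mul, map_pow, thueEval_root, map_ofNat, map_intCast]

theorem norm_thueEval_zpow (b : ℤ) (z : ℂ) (hz : z ^ 5 + 4 * (b : ℂ) ^ 4 * z - 1 = 0)
    (u : (AdjoinRoot (thuePoly b))ˣ) (n m : ℤ) :
    ‖thueEval b z hz (u * (thueUnit₁ b ^ n * thueUnit₂ b ^ m) : (AdjoinRoot (thuePoly b))ˣ)‖ =
      ‖thueEval b z hz u‖ * (‖z‖ ^ n * ‖z ^ 2 + 2 * b * z + 2 * b ^ 2‖ ^ m) := by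
  have e : thueEval b z hz
      (u * (thueUnit₁ b ^ n * thueUnit₂ b ^ m) : (AdjoinRoot (thuePoly b))ˣ) =
      thueEval b z hz u * (thueEval b z hz (thueUnit₁ b) ^ n *
        thueEval b z hz (thueUnit₂ b) ^ m) := by
    have : Units.map (thueEval b z hz).toMonoidHom (u * (thueUnit₁ b ^ n * thueUnit₂ b ^ m)) =
        Units.map (thueEval b z hz).toMonoidHom u *
          (Units.map (thueEval b z hz).toMonoidHom (thueUnit₁ b) ^ n *
            Units.map (thueEval b z hz).toMonoidHom (thueUnit₂ b) ^ m) := by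
      rw [map_mul, map_mul, map_zpow, map_zpow]
    have := congrArg Units.val this
    rw [Units.val_mul, Units.val_mul, Units.val_zpow_eq_zpow_val,
      Units.val_zpow_eq_zpow_val] at this
    exact this
  rw [e, thueEval_thueUnit₁, thueEval_thueUnit₂, norm_mul, norm_mul, norm_zpow, norm_zpow]

theorem norm_thueEval_pos (b : ℤ) (z : ℂ) (hz : z ^ 5 + 4 * (b : ℂ) ^ 4 * z - 1 = 0)
    (u : (AdjoinRoot (thuePoly b))ˣ) : 0 < ‖thueEval b z hz u‖ :=
  norm_pos_iff.2 (u.isUnit.map (thueEval b z hz)).ne_zero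

namespace ThueRoots

variable {b : ℤ} {t₀ : ℝ} {t₁ t₂ : ℂ}

theorem exists_eq_zpow_of_bounds (h : ThueRoots b t₀ t₁ t₂) (hb : 1 ≤ b)
    (ht₀ : t₀ < 1) (ht₁ : ‖t₁‖ ≤ 2 * b) (ht₂ : ‖t₂‖ ≤ 2 * b)
    (ht₁' : 1 < ‖t₁‖) (ht₂' : 1 < ‖t₂‖)
    (hx₁ : 1 < ‖t₁ ^ 2 + 2 * b * t₁ + 2 * b ^ 2‖)
    {K ρ₁ ρ₂ y₀ α β l g w₀ w₁ w₂ s₁ s₂ : ℝ}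
    (hK : 0 < K) (hKa : K * t₀ ≤ 1)
    (hρ₁ : Real.log ‖t₁‖ ≤ ρ₁ * -Real.log t₀) (hρ₂ : Real.log ‖t₂‖ ≤ ρ₂ * -Real.log t₀)
    (hy₀ : 0 ≤ y₀) (hy₁ : y₀ ≤ 1) (hα : 0 < α) (hβ : 0 < β) (hl : 0 < l) (hg : 0 < g)
    (hKα : ρ₁ * -Real.log (K * t₀) ≤ Real.log α) (hKβ : ρ₂ * -Real.log (K * t₀) ≤ Real.log β)
    (hEl : y₀ * (Real.log ‖t₁ ^ 2 + 2 * b * t₁ + 2 * b ^ 2‖ +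
      ρ₁ * Real.log (t₀ ^ 2 + 2 * b * t₀ + 2 * b ^ 2)) ≤ -Real.log l)
    (hEg : (1 - y₀) * (Real.log ‖t₁ ^ 2 + 2 * b * t₁ + 2 * b ^ 2‖ +
      ρ₁ * Real.log (t₀ ^ 2 + 2 * b * t₀ + 2 * b ^ 2)) ≤ Real.log g)
    (hw₀ : 0 < w₀) (hw₁ : 0 < w₁) (hw₂ : 0 < w₂)
    (hW₀ : w₀ ≤ ‖5 * (t₀ : ℂ) ^ 4 + 4 * (b : ℂ) ^ 4‖)
    (hW₁ : w₁ ≤ ‖5 * t₁ ^ 4 + 4 * (b : ℂ) ^ 4‖) (hW₂ : w₂ ≤ ‖5 * t₂ ^ 4 + 4 * (b : ℂ) ^ 4‖)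
    (hs₁ : ‖t₁‖ ^ 2 ≤ s₁) (hs₂ : ‖t₂‖ ^ 2 ≤ s₂)
    (hl₄ : K / w₀ + 2 * (α / w₁) * l + 2 * (β / w₂) / l < 1)
    (hg₄ : K / w₀ + 2 * (α / w₁) * g + 2 * (β / w₂) / g < 1)
    (hl₂ : K / w₀ * t₀ ^ 2 + 2 * (α / w₁) * s₁ * l + 2 * (β / w₂) * s₂ / l < 1)
    (hg₂ : K / w₀ * t₀ ^ 2 + 2 * (α / w₁) * s₁ * g + 2 * (β / w₂) * s₂ / g < 1)
    (u : (AdjoinRoot (thuePoly b))ˣ) :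
    ∃ (s : ℤˣ) (n m : ℤ), (u : AdjoinRoot (thuePoly b)) = ((s : ℤ) : AdjoinRoot (thuePoly b)) *
      ((thueUnit₁ b ^ n * thueUnit₂ b ^ m : (AdjoinRoot (thuePoly b))ˣ) :
        AdjoinRoot (thuePoly b)) := by
  have hb' : (1 : ℝ) ≤ b := by exact_mod_cast hb
  have hnt₀ : ‖(t₀ : ℂ)‖ = t₀ := by simp [abs_of_pos h.pos₀]
  have hnx₀ : ‖(t₀ : ℂ) ^ 2 + 2 * b * t₀ + 2 * b ^ 2‖ = t₀ ^ 2 + 2 * b * t₀ + 2 * b ^ 2 := by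
    have : (t₀ : ℂ) ^ 2 + 2 * b * t₀ + 2 * b ^ 2 =
        ((t₀ ^ 2 + 2 * b * t₀ + 2 * b ^ 2 : ℝ) : ℂ) := by push_cast; ring
    have h0 := h.pos₀
    rw [this, Complex.norm_real, Real.norm_of_nonneg (by positivity)]
  have ha := h.norm_unit (thueUnit₁ b)
  have hx := h.norm_unit (thueUnit₂ b)
  have hx₂ := norm_thueEval_pos b t₂ h.root₂ (thueUnit₂ b)
  simp only [thueEval_thueUnit₁, thueEval_thueUnit₂, hnt₀, hnx₀] at ha hx hx₂
  have hx₀ : 1 ≤ t₀ ^ 2 + 2 * b * t₀ + 2 * b ^ 2 := by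
    have h0 := h.pos₀
    nlinarith [mul_pos h0 h0, mul_pos h0 (by linarith : (0 : ℝ) < b)]
  obtain ⟨n, m, v, hv₁, hv₂, h₀, h₁, h₂⟩ := exists_zpow_reduction h.pos₀ ht₀ ht₁' ht₂' hx₀ hx₁ hx₂
    (norm_thueEval_pos b t₀ h.root₀ u) (norm_thueEval_pos b t₁ h.root₁ u)
    (norm_thueEval_pos b t₂ h.root₂ u) ha hx (h.norm_unit u) hK hKa hρ₁ hρ₂ hy₀ hy₁ hα hβ hl hg
    hKα hKβ hEl hEg
  have hv : 0 < v := by linarith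
  have e₀ := norm_thueEval_zpow b t₀ h.root₀ u n m
  have e₁ := norm_thueEval_zpow b t₁ h.root₁ u n m
  have e₂ := norm_thueEval_zpow b t₂ h.root₂ u n m
  rw [hnt₀, hnx₀] at e₀
  rw [← e₀] at h₀
  rw [← e₁] at h₁
  rw [← e₂] at h₂
  have d₀ := div_le_div₀ hK.le h₀ hw₀ hW₀
  have d₁ := div_le_div₀ (by positivity) h₁ hw₁ hW₁
  have d₂ := div_le_div₀ (by positivity) h₂ hw₂ hW₂
  have c₄ := add_mul_add_div_lt_one (by positivity) hl hv₁ hv₂ hl₄ hg₄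
  have hs₁0 : 0 ≤ s₁ := (sq_nonneg _).trans hs₁
  have hs₂0 : 0 ≤ s₂ := (sq_nonneg _).trans hs₂
  have c₂ := add_mul_add_div_lt_one (by positivity) hl hv₁ hv₂ hl₂ hg₂
  have q₁ : α * v / w₁ = α / w₁ * v := by ring
  have q₂ : β / v / w₂ = β / w₂ / v := by ring
  rw [q₁] at d₁
  rw [q₂] at d₂
  obtain ⟨s, hs⟩ := h.eq_one_or_root_of_small hb (by linarith) ht₁ ht₂
    (u * (thueUnit₁ b ^ n * thueUnit₂ b ^ m)) (by
      refine lt_of_le_of_lt ?_ c₄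
      have : 2 * (β / w₂) / v = 2 * (β / w₂ / v) := by ring
      linarith) (by
      refine lt_of_le_of_lt ?_ c₂
      have r₀ := mul_le_mul_of_nonneg_right d₀ (sq_nonneg t₀)
      have r₁ := mul_le_mul d₁ hs₁ (sq_nonneg _) (by positivity)
      have r₂ := mul_le_mul d₂ hs₂ (sq_nonneg _) (by positivity)
      have : 2 * (β / w₂) * s₂ / v = 2 * (β / w₂ / v * s₂) := by ring
      linarith)
  have hu : ∀ k : ℤ, (u * (thueUnit₁ b ^ n * thueUnit₂ b ^ m) : (AdjoinRoot (thuePoly b))ˣ) =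
      ((Units.map (Int.castRingHom (AdjoinRoot (thuePoly b))).toMonoidHom s) * thueUnit₁ b ^ k) →
      ∃ (s : ℤˣ) (n m : ℤ), (u : AdjoinRoot (thuePoly b)) =
        ((s : ℤ) : AdjoinRoot (thuePoly b)) *
          ((thueUnit₁ b ^ n * thueUnit₂ b ^ m : (AdjoinRoot (thuePoly b))ˣ) :
            AdjoinRoot (thuePoly b)) := by
    intro k hk
    refine ⟨s, k - n, -m, ?_⟩
    have : u = (Units.map (Int.castRingHom (AdjoinRoot (thuePoly b))).toMonoidHom s) *
        (thueUnit₁ b ^ (k - n) * thueUnit₂ b ^ (-m)) := by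
      rw [eq_mul_inv_of_mul_eq hk, mul_inv, zpow_sub, zpow_neg]
      group
    exact congrArg Units.val this
  rcases hs with hs | hs
  · exact hu 0 (Units.ext (by rw [hs]; simp))
  · exact hu 1 (Units.ext (by rw [hs, zpow_one]; rfl))

end ThueRoots

namespace ThueRoots

variable {b : ℤ} {t₀ : ℝ} {t₁ t₂ : ℂ}

theorem eq_zero_of_zpow_eq (h : ThueRoots b t₀ t₁ t₂) (hb : 1 ≤ b) (ht₀ : t₀ < 1)
    (ht₁ : 1 < ‖t₁‖) (hx₁ : 1 < ‖t₁ ^ 2 + 2 * b * t₁ + 2 * b ^ 2‖) {s : ℤˣ} {n m : ℤ}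
    (hs : ((thueUnit₁ b ^ n * thueUnit₂ b ^ m : (AdjoinRoot (thuePoly b))ˣ) :
      AdjoinRoot (thuePoly b)) = ((s : ℤ) : AdjoinRoot (thuePoly b))) : n = 0 ∧ m = 0 := by
  have hb' : (1 : ℝ) ≤ b := by exact_mod_cast hb
  have h0 := h.pos₀
  have hnt₀ : ‖(t₀ : ℂ)‖ = t₀ := by simp [abs_of_pos h.pos₀]
  have hx₀ : 1 < ‖(t₀ : ℂ) ^ 2 + 2 * b * t₀ + 2 * b ^ 2‖ := by
    have : (t₀ : ℂ) ^ 2 + 2 * b * t₀ + 2 * b ^ 2 =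
        ((t₀ ^ 2 + 2 * b * t₀ + 2 * b ^ 2 : ℝ) : ℂ) := by push_cast; ring
    rw [this, Complex.norm_real, Real.norm_of_nonneg (by positivity)]
    nlinarith [mul_pos h0 h0, mul_pos h0 (by linarith : (0 : ℝ) < b)]
  have key : ∀ (z : ℂ) (hz : z ^ 5 + 4 * (b : ℂ) ^ 4 * z - 1 = 0), 0 < ‖z‖ →
      0 < ‖z ^ 2 + 2 * b * z + 2 * b ^ 2‖ →
      n * Real.log ‖z‖ + m * Real.log ‖z ^ 2 + 2 * b * z + 2 * b ^ 2‖ = 0 := by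
    intro z hz h1 h2
    have h3 := norm_thueEval_zpow b z hz 1 n m
    rw [one_mul, hs, map_intCast, Units.val_one, map_one, norm_one, one_mul] at h3
    have h4 : ‖((s : ℤ) : ℂ)‖ = 1 := by
      rcases Int.units_eq_one_or s with rfl | rfl <;> simp
    rw [h4] at h3
    have h5 := congrArg Real.log h3
    rw [Real.log_one, Real.log_mul (by positivity) (by positivity), Real.log_zpow,
      Real.log_zpow] at h5
    exact h5.symm
  have k₀ := key t₀ h.root₀ (by rw [hnt₀]; exact h0) (by linarith)
  have k₁ := key t₁ h.root₁ (by linarith) (by linarith)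
  rw [hnt₀] at k₀
  have l₀ := Real.log_neg h0 ht₀
  have l₁ := Real.log_pos ht₁
  have m₀ := Real.log_pos hx₀
  have m₁ := Real.log_pos hx₁
  have hm : (m : ℝ) = 0 := by
    have : (m : ℝ) * (Real.log ‖t₁ ^ 2 + 2 * b * t₁ + 2 * b ^ 2‖ * -Real.log t₀ +
        Real.log ‖(t₀ : ℂ) ^ 2 + 2 * b * t₀ + 2 * b ^ 2‖ * Real.log ‖t₁‖) = 0 := by
      linear_combination (-Real.log t₀) * k₁ + Real.log ‖t₁‖ * k₀
    rcases mul_eq_zero.1 this with h | h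
    · exact h
    · have := mul_pos m₁ (neg_pos.2 l₀)
      have := mul_pos m₀ l₁
      linarith
  rw [hm, zero_mul, add_zero] at k₁
  have hn : (n : ℝ) = 0 := (mul_eq_zero.1 k₁).resolve_right l₁.ne'
  exact ⟨by exact_mod_cast hn, by exact_mod_cast hm⟩

theorem zpow_injective (h : ThueRoots b t₀ t₁ t₂) (hb : 1 ≤ b) (ht₀ : t₀ < 1)
    (ht₁ : 1 < ‖t₁‖) (hx₁ : 1 < ‖t₁ ^ 2 + 2 * b * t₁ + 2 * b ^ 2‖) {v w : ℤˣ × ℤ × ℤ}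
    (hvw : ((v.1 : ℤ) : AdjoinRoot (thuePoly b)) *
        ((thueUnit₁ b ^ v.2.1 * thueUnit₂ b ^ v.2.2 : (AdjoinRoot (thuePoly b))ˣ) :
          AdjoinRoot (thuePoly b)) =
      ((w.1 : ℤ) : AdjoinRoot (thuePoly b)) *
        ((thueUnit₁ b ^ w.2.1 * thueUnit₂ b ^ w.2.2 : (AdjoinRoot (thuePoly b))ˣ) :
          AdjoinRoot (thuePoly b))) : v = w := by
  obtain ⟨s, n, m⟩ := v
  obtain ⟨s', n', m'⟩ := w
  simp only at hvw
  let ι := Units.map (Int.castRingHom (AdjoinRoot (thuePoly b))).toMonoidHom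
  have h1 : ι s * (thueUnit₁ b ^ n * thueUnit₂ b ^ m) =
      ι s' * (thueUnit₁ b ^ n' * thueUnit₂ b ^ m') := Units.ext hvw
  have h2 : thueUnit₁ b ^ (n - n') * thueUnit₂ b ^ (m - m') = ι (s' * s⁻¹) := by
    rw [map_mul, map_inv, zpow_sub, zpow_sub, eq_mul_inv_iff_mul_eq]
    calc _ = ι s * (thueUnit₁ b ^ n * thueUnit₂ b ^ m) *
        ((thueUnit₁ b ^ n')⁻¹ * (thueUnit₂ b ^ m')⁻¹) := by
          simp only [mul_comm, mul_assoc, mul_left_comm]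
      _ = _ := by
          rw [h1, mul_assoc, ← mul_inv, mul_inv_cancel, mul_one]
  obtain ⟨hn, hm⟩ := h.eq_zero_of_zpow_eq hb ht₀ ht₁ hx₁ (congrArg Units.val h2)
  obtain rfl : n = n' := by linarith
  obtain rfl : m = m' := by linarith
  have h3 := congrArg Units.val (mul_right_cancel h1)
  have h4 : ((s : ℤ) : ℂ) = ((s' : ℤ) : ℂ) := by
    have := congrArg (thueEval b t₁ h.root₁) h3
    change thueEval b t₁ h.root₁ ((s : ℤ) : AdjoinRoot (thuePoly b)) =
      thueEval b t₁ h.root₁ ((s' : ℤ) : AdjoinRoot (thuePoly b)) at this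
    rwa [map_intCast, map_intCast] at this
  rw [show s = s' from Units.ext (by exact_mod_cast h4)]

end ThueRoots

theorem exists_root_norm_sub_le {p : ℂ[X]} {z : ℂ} {r : ℝ} (hr : 0 < r)
    (h : p.natDegree * ‖p.eval z‖ < r * ‖p.derivative.eval z‖) :
    ∃ t, p.eval t = 0 ∧ ‖z - t‖ ≤ r := by
  by_cases hz : p.eval z = 0
  · exact ⟨z, hz, by simpa using hr.le⟩
  by_contra! hc
  have hsum := (IsAlgClosed.splits p).eval_derivative_div_eval_of_ne_zero hz
  have hp : p ≠ 0 := by rintro rfl; simp at hz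
  have hle : ‖(p.roots.map fun t => 1 / (z - t)).sum‖ ≤ p.roots.card * (1 / r) := by
    refine (norm_multiset_sum_le _).trans ?_
    rw [Multiset.map_map, ← nsmul_eq_mul]
    have := Multiset.sum_le_card_nsmul (p.roots.map (norm ∘ fun t => 1 / (z - t))) (1 / r) (by
      intro x hx
      obtain ⟨t, ht, rfl⟩ := Multiset.mem_map.1 hx
      have := hc t (isRoot_of_mem_roots ht)
      simp only [Function.comp_apply, norm_div, norm_one]
      exact one_div_le_one_div_of_le hr this.le)
    simpa using this
  rw [← hsum, norm_div, div_le_iff₀ (norm_pos_iff.2 hz)] at hle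
  have hcard : (p.roots.card : ℝ) ≤ p.natDegree := by exact_mod_cast p.card_roots'
  have h1 : r * ‖p.derivative.eval z‖ ≤ p.roots.card * ‖p.eval z‖ := by
    have := mul_le_mul_of_nonneg_left hle hr.le
    refine this.trans (le_of_eq ?_)
    field_simp
  have h2 := mul_le_mul_of_nonneg_right hcard (norm_nonneg (p.eval z))
  linarith

theorem exists_thueRoot_norm_sub_le (b : ℤ) {z : ℂ} {r : ℝ} (hr : 0 < r)
    (h : 5 * ‖z ^ 5 + 4 * (b : ℂ) ^ 4 * z - 1‖ < r * ‖5 * z ^ 4 + 4 * (b : ℂ) ^ 4‖) :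
    ∃ t : ℂ, t ^ 5 + 4 * (b : ℂ) ^ 4 * t - 1 = 0 ∧ ‖z - t‖ ≤ r := by
  have he : ∀ t, ((thuePoly b).map (Int.castRingHom ℂ)).eval t =
      t ^ 5 + 4 * (b : ℂ) ^ 4 * t - 1 := fun t => by rw [eval_map, eval₂_thuePoly]
  have hd : ((thuePoly b).map (Int.castRingHom ℂ)).derivative.eval z =
      5 * z ^ 4 + 4 * (b : ℂ) ^ 4 := by
    rw [derivative_map, eval_map]
    simp only [thuePoly, derivative_sub, derivative_add, derivative_X_pow, derivative_C_mul,
      derivative_X, derivative_one, eval₂_add, eval₂_sub, eval₂_mul, eval₂_pow, eval₂_X, eval₂_C,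
      eval₂_one, eval₂_zero]
    simp
  obtain ⟨t, ht, hz⟩ := exists_root_norm_sub_le (p := (thuePoly b).map (Int.castRingHom ℂ)) hr (by
    rw [he, hd, (thuePoly_monic b).natDegree_map, natDegree_thuePoly]
    exact_mod_cast h)
  exact ⟨t, by rw [← he, ht], hz⟩

theorem exists_real_thueRoot (b : ℤ) {p q : ℝ} (hpq : p ≤ q)
    (hp : p ^ 5 + 4 * (b : ℝ) ^ 4 * p - 1 ≤ 0) (hq : 0 ≤ q ^ 5 + 4 * (b : ℝ) ^ 4 * q - 1) :
    ∃ t : ℝ, p ≤ t ∧ t ≤ q ∧ (t : ℂ) ^ 5 + 4 * (b : ℂ) ^ 4 * t - 1 = 0 := by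
  have hc : ContinuousOn (fun x : ℝ => x ^ 5 + 4 * (b : ℝ) ^ 4 * x - 1) (Set.Icc p q) := by
    fun_prop
  obtain ⟨t, ht, h0⟩ := intermediate_value_Icc hpq hc ⟨hp, hq⟩
  refine ⟨t, ht.1, ht.2, ?_⟩
  have := congrArg (fun x : ℝ => (x : ℂ)) h0
  push_cast at this
  exact this

theorem norm_derivative_ge {b : ℤ} {t : ℂ} (h : t ^ 5 + 4 * (b : ℂ) ^ 4 * t - 1 = 0)
    {w s : ℝ} (hs : ‖t‖ ≤ s) (hw : 0 ≤ w) (hws : w * s ≤ ‖5 - 16 * (b : ℂ) ^ 4 * t‖) :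
    w ≤ ‖5 * t ^ 4 + 4 * (b : ℂ) ^ 4‖ := by
  have ht : t ≠ 0 := by rintro rfl; simp at h
  have e : 5 - 16 * (b : ℂ) ^ 4 * t = (5 * t ^ 4 + 4 * (b : ℂ) ^ 4) * t := by
    linear_combination (-5) * h
  rw [e, norm_mul] at hws
  have := mul_le_mul_of_nonneg_left hs hw
  exact le_of_mul_le_mul_right (this.trans hws) (norm_pos_iff.2 ht)

theorem mul_log_le_mul_log {x y : ℝ} {k n : ℕ} (hx : 0 < x) (h : x ^ k ≤ y ^ n) :
    (k : ℝ) * Real.log x ≤ n * Real.log y := by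
  rw [← Real.log_pow, ← Real.log_pow]
  exact Real.log_le_log (by positivity) h

theorem norm_le_of_sq_add_sq_le {z : ℂ} {x : ℝ} (hx : 0 ≤ x) (h : z.re ^ 2 + z.im ^ 2 ≤ x ^ 2) :
    ‖z‖ ≤ x := by
  rw [← Complex.sq_norm_sub_sq_re z] at h
  exact (abs_le_of_sq_le_sq' (by linarith) hx).2

theorem le_norm_of_le_sq_add_sq {z : ℂ} {x : ℝ} (h : x ^ 2 ≤ z.re ^ 2 + z.im ^ 2) : x ≤ ‖z‖ := by
  rw [← Complex.sq_norm_sub_sq_re z] at h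
  exact (abs_le_of_sq_le_sq' (by linarith) (norm_nonneg z)).2

theorem exists_thueRoots_one : ∃ (t₀ : ℝ) (t₁ t₂ : ℂ), ThueRoots 1 t₀ t₁ t₂ ∧
    t₀ ∈ Set.Icc (2497 / 10000) (2498 / 10000) ∧
    t₁.re ∈ Set.Icc (9319 / 10000) (9339 / 10000) ∧
    t₁.im ∈ Set.Icc (10053 / 10000) (10073 / 10000) ∧
    t₂.re ∈ Set.Icc (-10588 / 10000) (-10568 / 10000) ∧
    t₂.im ∈ Set.Icc (10028 / 10000) (10048 / 10000) := by
  have hpow : ∀ a c : ℝ, (⟨a, c⟩ : ℂ) ^ 2 = ⟨a ^ 2 - c ^ 2, 2 * a * c⟩ := by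
    intro a c
    apply Complex.ext <;> simp [pow_two]
    ring
  obtain ⟨t₀, h₀, h₀', hr₀⟩ := exists_real_thueRoot 1 (p := 2497 / 10000) (q := 2498 / 10000)
    (by norm_num) (by norm_num) (by norm_num)
  have hd : ∀ a c : ℝ, 5 * (⟨a, c⟩ : ℂ) ^ 4 + 4 * ((1 : ℤ) : ℂ) ^ 4 =
      ⟨5 * ((a ^ 2 - c ^ 2) ^ 2 - (2 * a * c) ^ 2) + 4, 10 * (a ^ 2 - c ^ 2) * (2 * a * c)⟩ := by
    intro a c
    rw [show (⟨a, c⟩ : ℂ) ^ 4 = (⟨a, c⟩ ^ 2) ^ 2 by ring, hpow, hpow]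
    apply Complex.ext <;> simp
    ring
  have hf : ∀ a c : ℝ, (⟨a, c⟩ : ℂ) ^ 5 + 4 * ((1 : ℤ) : ℂ) ^ 4 * ⟨a, c⟩ - 1 =
      ⟨a * ((a ^ 2 - c ^ 2) ^ 2 - (2 * a * c) ^ 2) - c * (2 * (a ^ 2 - c ^ 2) * (2 * a * c)) +
          4 * a - 1,
        a * (2 * (a ^ 2 - c ^ 2) * (2 * a * c)) + c * ((a ^ 2 - c ^ 2) ^ 2 - (2 * a * c) ^ 2) +
          4 * c⟩ := by
    intro a c
    rw [show (⟨a, c⟩ : ℂ) ^ 5 = ⟨a, c⟩ * (⟨a, c⟩ ^ 2) ^ 2 by ring, hpow, hpow]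
    apply Complex.ext <;> simp
  obtain ⟨t₁, hr₁, h₁⟩ := exists_thueRoot_norm_sub_le 1
    (z := ⟨9329 / 10000, 10063 / 10000⟩) (r := 1 / 1000) (by norm_num) (by
      rw [hf, hd]
      refine lt_of_le_of_lt (b := 5 * (1 / 1000)) (mul_le_mul_of_nonneg_left
        (norm_le_of_sq_add_sq_le (by norm_num) (by norm_num)) (by norm_num)) ?_
      refine lt_of_lt_of_le (b := 1 / 1000 * 13) (by norm_num) (mul_le_mul_of_nonneg_left
        (le_norm_of_le_sq_add_sq (by norm_num)) (by norm_num)))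
  obtain ⟨t₂, hr₂, h₂⟩ := exists_thueRoot_norm_sub_le 1
    (z := ⟨-10578 / 10000, 10038 / 10000⟩) (r := 1 / 1000) (by norm_num) (by
      rw [hf, hd]
      refine lt_of_le_of_lt (b := 5 * (2 / 1000)) (mul_le_mul_of_nonneg_left
        (norm_le_of_sq_add_sq_le (by norm_num) (by norm_num)) (by norm_num)) ?_
      refine lt_of_lt_of_le (b := 1 / 1000 * 18) (by norm_num) (mul_le_mul_of_nonneg_left
        (le_norm_of_le_sq_add_sq (by norm_num)) (by norm_num)))
  have re₁ := abs_le.1 ((Complex.abs_re_le_norm _).trans h₁)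
  have im₁ := abs_le.1 ((Complex.abs_im_le_norm _).trans h₁)
  have re₂ := abs_le.1 ((Complex.abs_re_le_norm _).trans h₂)
  have im₂ := abs_le.1 ((Complex.abs_im_le_norm _).trans h₂)
  simp only [Complex.sub_re, Complex.sub_im] at re₁ im₁ re₂ im₂
  refine ⟨t₀, t₁, t₂, ⟨hr₀, hr₁, hr₂, by linarith, by linarith,
    by linarith, by linarith, by linarith⟩, ⟨h₀, h₀'⟩, ⟨?_, ?_⟩, ⟨?_, ?_⟩, ⟨?_, ?_⟩, ⟨?_, ?_⟩⟩ <;>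
  linarith

theorem sq_mem_Icc {x p q : ℝ} (hp : 0 ≤ p) (h : x ∈ Set.Icc p q) :
    x ^ 2 ∈ Set.Icc (p ^ 2) (q ^ 2) :=
  ⟨pow_le_pow_left₀ hp h.1 2, pow_le_pow_left₀ (hp.trans h.1) h.2 2⟩

theorem norm_bounds_one {t : ℂ} (hre : t.re ∈ Set.Icc (9319 / 10000) (9339 / 10000))
    (him : t.im ∈ Set.Icc (10053 / 10000) (10073 / 10000)) :
    11 / 10 ≤ ‖t‖ ∧ ‖t‖ ≤ 13738 / 10000 ∧
    11 / 10 ≤ ‖t ^ 2 + 2 * ((1 : ℤ) : ℂ) * t + 2 * ((1 : ℤ) : ℂ) ^ 2‖ ∧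
    ‖t ^ 2 + 2 * ((1 : ℤ) : ℂ) * t + 2 * ((1 : ℤ) : ℂ) ^ 2‖ ≤ 54 / 10 ∧
    137 / 10 * (13738 / 10000) ≤ ‖5 - 16 * ((1 : ℤ) : ℂ) ^ 4 * t‖ := by
  obtain ⟨r₁, r₂⟩ := sq_mem_Icc (by norm_num) hre
  obtain ⟨m₁, m₂⟩ := sq_mem_Icc (by norm_num) him
  obtain ⟨a₁, a₂⟩ := hre
  obtain ⟨c₁, c₂⟩ := him
  have e₁ : (t ^ 2 + 2 * ((1 : ℤ) : ℂ) * t + 2 * ((1 : ℤ) : ℂ) ^ 2).re =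
      t.re ^ 2 - t.im ^ 2 + 2 * t.re + 2 := by
    simp [pow_two]
  have e₂ : (t ^ 2 + 2 * ((1 : ℤ) : ℂ) * t + 2 * ((1 : ℤ) : ℂ) ^ 2).im =
      2 * (t.im * (t.re + 1)) := by
    simp [pow_two]; ring
  have i₁ : 11 / 10 ≤ t.re ^ 2 - t.im ^ 2 + 2 * t.re + 2 := by linarith
  refine ⟨le_norm_of_le_sq_add_sq (by linarith),
    norm_le_of_sq_add_sq_le (by norm_num) (by linarith),
    le_norm_of_le_sq_add_sq ?_, norm_le_of_sq_add_sq_le (by norm_num) ?_,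
    le_norm_of_le_sq_add_sq ?_⟩
  · rw [e₁, e₂]
    nlinarith [sq_nonneg (2 * (t.im * (t.re + 1)))]
  · rw [e₁, e₂]
    have i₂ : t.re ^ 2 - t.im ^ 2 + 2 * t.re + 2 ≤ 373 / 100 := by linarith
    have i₃ : 0 ≤ t.im * (t.re + 1) := mul_nonneg (by linarith) (by linarith)
    have i₄ : t.im * (t.re + 1) ≤ 10073 / 10000 * (19339 / 10000) :=
      mul_le_mul (by linarith) (by linarith) (by linarith) (by norm_num)
    have i₅ := pow_le_pow_left₀ (by linarith) i₂ 2
    have i₆ := pow_le_pow_left₀ i₃ i₄ 2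
    linarith
  · simp
    linarith

theorem norm_bounds_two {t : ℂ} (hre : t.re ∈ Set.Icc (-10588 / 10000) (-10568 / 10000))
    (him : t.im ∈ Set.Icc (10028 / 10000) (10048 / 10000)) :
    11 / 10 ≤ ‖t‖ ∧ ‖t‖ ≤ 146 / 100 ∧
    185 / 10 * (146 / 100) ≤ ‖5 - 16 * ((1 : ℤ) : ℂ) ^ 4 * t‖ := by
  have hre' : -t.re ∈ Set.Icc (10568 / 10000) (10588 / 10000) :=
    ⟨by linarith [hre.2], by linarith [hre.1]⟩
  obtain ⟨r₁, r₂⟩ := sq_mem_Icc (by norm_num) hre'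
  obtain ⟨m₁, m₂⟩ := sq_mem_Icc (by norm_num) him
  obtain ⟨a₁, a₂⟩ := hre
  rw [neg_sq] at r₁ r₂
  refine ⟨le_norm_of_le_sq_add_sq (by linarith),
    norm_le_of_sq_add_sq_le (by norm_num) (by linarith), le_norm_of_le_sq_add_sq ?_⟩
  simp
  linarith

theorem exists_eq_zpow_of_eq_one : ∃ (t₀ : ℝ) (t₁ t₂ : ℂ), ThueRoots 1 t₀ t₁ t₂ ∧ t₀ < 1 ∧
    1 < ‖t₁‖ ∧ 1 < ‖t₁ ^ 2 + 2 * ((1 : ℤ) : ℂ) * t₁ + 2 * ((1 : ℤ) : ℂ) ^ 2‖ ∧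
    ∀ u : (AdjoinRoot (thuePoly 1))ˣ, ∃ (s : ℤˣ) (n m : ℤ), (u : AdjoinRoot (thuePoly 1)) =
      ((s : ℤ) : AdjoinRoot (thuePoly 1)) *
        ((thueUnit₁ 1 ^ n * thueUnit₂ 1 ^ m : (AdjoinRoot (thuePoly 1))ˣ) :
          AdjoinRoot (thuePoly 1)) := by
  obtain ⟨t₀, t₁, t₂, H, ⟨h₀, h₀'⟩, re₁, im₁, re₂, im₂⟩ := exists_thueRoots_one
  obtain ⟨ht₁', ht₁, hx₁', hx₁, hw₁⟩ := norm_bounds_one re₁ im₁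
  obtain ⟨ht₂', ht₂, hw₂⟩ := norm_bounds_two re₂ im₂
  replace ht₁' : 1 < ‖t₁‖ := by linarith
  replace ht₂' : 1 < ‖t₂‖ := by linarith
  replace hx₁' : 1 < ‖t₁ ^ 2 + 2 * ((1 : ℤ) : ℂ) * t₁ + 2 * ((1 : ℤ) : ℂ) ^ 2‖ :=
    lt_of_lt_of_le (by norm_num) hx₁'
  have hlog₀ : Real.log (10000 / 2498) ≤ -Real.log t₀ := by
    rw [← Real.log_inv]
    refine Real.log_le_log (by norm_num) ?_
    rw [le_inv_comm₀ (by norm_num) (by linarith)]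
    linarith
  have hlogK : -Real.log (18 / 10 * t₀) ≤ Real.log (10000 / 4494) := by
    rw [← Real.log_inv]
    refine Real.log_le_log (inv_pos.2 (by linarith)) ?_
    rw [inv_le_comm₀ (by linarith) (by norm_num)]
    linarith
  have hx₀ : Real.log (t₀ ^ 2 + 2 * ((1 : ℤ) : ℝ) * t₀ + 2 * ((1 : ℤ) : ℝ) ^ 2) ≤
      Real.log (2563 / 1000) := by
    refine Real.log_le_log (by push_cast; nlinarith) ?_
    push_cast
    nlinarith
  have hlt₁ := Real.log_le_log (by linarith) ht₁
  have hlt₂ := Real.log_le_log (by linarith) ht₂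
  have hlx₁ := Real.log_le_log (by linarith) hx₁
  have p₁ := mul_log_le_mul_log (x := 13738 / 10000) (y := 10000 / 2498) (k := 100) (n := 23)
    (by norm_num) (by norm_num)
  have p₂ := mul_log_le_mul_log (x := 146 / 100) (y := 10000 / 2498) (k := 40) (n := 11)
    (by norm_num) (by norm_num)
  have p₃ := mul_log_le_mul_log (x := 10000 / 4494) (y := 1204 / 1000) (k := 23) (n := 100)
    (by norm_num) (by norm_num)
  have p₄ := mul_log_le_mul_log (x := 10000 / 4494) (y := 1247 / 1000) (k := 11) (n := 40)
    (by norm_num) (by norm_num)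
  have p₅ := mul_log_le_mul_log (x := 2563 / 1000) (y := 1242 / 1000) (k := 23) (n := 100)
    (by norm_num) (by norm_num)
  have p₆ := mul_log_le_mul_log (x := 54 / 10 * (1242 / 1000)) (y := 28 / 10) (k := 27) (n := 50)
    (by norm_num) (by norm_num)
  have p₇ := mul_log_le_mul_log (x := 54 / 10 * (1242 / 1000)) (y := 241 / 100) (k := 23) (n := 50)
    (by norm_num) (by norm_num)
  rw [Real.log_mul (by norm_num) (by norm_num)] at p₆ p₇
  push_cast at p₁ p₂ p₃ p₄ p₅ p₆ p₇
  have w₁ : (137 / 10 : ℝ) ≤ ‖5 * t₁ ^ 4 + 4 * ((1 : ℤ) : ℂ) ^ 4‖ :=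
    norm_derivative_ge H.root₁ ht₁ (by norm_num) hw₁
  have w₂ : (185 / 10 : ℝ) ≤ ‖5 * t₂ ^ 4 + 4 * ((1 : ℤ) : ℂ) ^ 4‖ :=
    norm_derivative_ge H.root₂ ht₂ (by norm_num) hw₂
  have w₀ : (4 : ℝ) ≤ ‖5 * (t₀ : ℂ) ^ 4 + 4 * ((1 : ℤ) : ℂ) ^ 4‖ := by
    have : 5 * (t₀ : ℂ) ^ 4 + 4 * ((1 : ℤ) : ℂ) ^ 4 = ((5 * t₀ ^ 4 + 4 : ℝ) : ℂ) := by
      push_cast; ring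
    rw [this, Complex.norm_real, Real.norm_of_nonneg (by positivity)]
    nlinarith [pow_nonneg (show 0 ≤ t₀ by linarith) 4]
  refine ⟨t₀, t₁, t₂, H, by linarith, ht₁', hx₁', ?_⟩
  exact H.exists_eq_zpow_of_bounds le_rfl (by linarith) (by push_cast; linarith)
    (by push_cast; linarith) ht₁' ht₂' hx₁' (K := 18 / 10) (ρ₁ := 23 / 100) (ρ₂ := 11 / 40)
    (y₀ := 54 / 100) (α := 1204 / 1000) (β := 1247 / 1000) (l := (28 / 10)⁻¹) (g := 241 / 100)
    (w₀ := 4) (w₁ := 137 / 10) (w₂ := 185 / 10) (s₁ := (13738 / 10000) ^ 2) (s₂ := (146 / 100) ^ 2)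
    (by norm_num) (by linarith) (by linarith) (by linarith) (by norm_num) (by norm_num)
    (by norm_num) (by norm_num) (by norm_num) (by norm_num) (by linarith) (by linarith)
    (by rw [Real.log_inv]; linarith) (by linarith) (by norm_num) (by norm_num) (by norm_num)
    w₀ w₁ w₂ (pow_le_pow_left₀ (norm_nonneg _) ht₁ 2) (pow_le_pow_left₀ (norm_nonneg _) ht₂ 2)
    (by norm_num) (by norm_num) (by nlinarith) (by nlinarith)

theorem exists_thueRoots_of_two_le {b : ℤ} (hb : 2 ≤ b) :
    ∃ (t₀ : ℝ) (t₁ t₂ : ℂ), ThueRoots b t₀ t₁ t₂ ∧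
      999 / 1000 / (4 * (b : ℝ) ^ 4) ≤ t₀ ∧ t₀ ≤ 1 / (4 * (b : ℝ) ^ 4) ∧
      ‖(b : ℂ) + b * Complex.I - t₁‖ ≤ 1 / 50 ∧ ‖-(b : ℂ) + b * Complex.I - t₂‖ ≤ 1 / 50 := by
  have hb' : (2 : ℝ) ≤ b := by exact_mod_cast hb
  have hb4 : (16 : ℝ) ≤ (b : ℝ) ^ 4 := by
    have := pow_le_pow_left₀ (by norm_num) hb' 4
    linarith
  have hp : 999 / 1000 / (4 * (b : ℝ) ^ 4) ≤ 1 / (4 * (b : ℝ) ^ 4) := by gcongr; norm_num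
  have hp0 : 0 < 999 / 1000 / (4 * (b : ℝ) ^ 4) := by positivity
  have hq : 1 / (4 * (b : ℝ) ^ 4) ≤ 1 / 64 := by gcongr; linarith
  obtain ⟨t₀, h₀, h₀', hr₀⟩ := exists_real_thueRoot b hp (by
      have h1 : 4 * (b : ℝ) ^ 4 * (999 / 1000 / (4 * (b : ℝ) ^ 4)) = 999 / 1000 := by field_simp
      have h2 := pow_le_pow_left₀ hp0.le (hp.trans hq) 5
      rw [h1]
      linarith) (by
      have h1 : 4 * (b : ℝ) ^ 4 * (1 / (4 * (b : ℝ) ^ 4)) = 1 := by field_simp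
      rw [h1]
      have := pow_pos (hp0.trans_le hp) 5
      linarith)
  have hz : ∀ z : ℂ, z ^ 4 = -(4 * (b : ℂ) ^ 4) →
      5 * ‖z ^ 5 + 4 * (b : ℂ) ^ 4 * z - 1‖ < 1 / 50 * ‖5 * z ^ 4 + 4 * (b : ℂ) ^ 4‖ := by
    intro z hz
    have e₁ : z ^ 5 + 4 * (b : ℂ) ^ 4 * z - 1 = -1 := by linear_combination z * hz
    have e₂ : 5 * z ^ 4 + 4 * (b : ℂ) ^ 4 = ((-(16 * b ^ 4) : ℝ) : ℂ) := by
      push_cast; linear_combination 5 * hz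
    rw [e₁, e₂, Complex.norm_real, norm_neg, norm_neg, norm_one,
      Real.norm_of_nonneg (by positivity)]
    linarith
  obtain ⟨t₁, hr₁, h₁⟩ := exists_thueRoot_norm_sub_le b (by norm_num)
    (hz ((b : ℂ) + b * Complex.I) (by
      linear_combination (b : ℂ) ^ 4 * (Complex.I ^ 2 + 4 * Complex.I + 5) * Complex.I_sq))
  obtain ⟨t₂, hr₂, h₂⟩ := exists_thueRoot_norm_sub_le b (by norm_num)
    (hz (-(b : ℂ) + b * Complex.I) (by
      linear_combination (b : ℂ) ^ 4 * (Complex.I ^ 2 - 4 * Complex.I + 5) * Complex.I_sq))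
  have re₁ := abs_le.1 ((Complex.abs_re_le_norm _).trans h₁)
  have im₁ := abs_le.1 ((Complex.abs_im_le_norm _).trans h₁)
  have re₂ := abs_le.1 ((Complex.abs_re_le_norm _).trans h₂)
  have im₂ := abs_le.1 ((Complex.abs_im_le_norm _).trans h₂)
  simp at re₁ im₁ re₂ im₂
  exact ⟨t₀, t₁, t₂, ⟨hr₀, hr₁, hr₂, by linarith, by linarith, by linarith, by linarith,
    by linarith⟩, h₀, h₀', h₁, h₂⟩

theorem norm_bounds_of_two_le {b : ℤ} (hb : 2 ≤ b) {z t : ℂ} (hre : z.re ^ 2 = (b : ℝ) ^ 2)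
    (him : z.im = b) (hzt : ‖z - t‖ ≤ 1 / 50) :
    1 < ‖t‖ ∧ ‖t‖ ≤ 143 / 100 * b ∧
      156 / 10 * (b : ℝ) ^ 4 * ‖t‖ ≤ ‖5 - 16 * (b : ℂ) ^ 4 * t‖ := by
  have hb' : (2 : ℝ) ≤ b := by exact_mod_cast hb
  have hb4 : (16 : ℝ) ≤ (b : ℝ) ^ 4 := by
    have := pow_le_pow_left₀ (by norm_num) hb' 4
    linarith
  have hz : ‖z‖ ≤ 1415 / 1000 * b :=
    norm_le_of_sq_add_sq_le (by linarith) (by rw [hre, him]; nlinarith)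
  have ht : ‖t‖ ≤ ‖z‖ + ‖z - t‖ := by
    have := norm_sub_le z (z - t)
    rwa [sub_sub_cancel] at this
  have him' := abs_le.1 ((Complex.abs_im_le_norm _).trans hzt)
  rw [Complex.sub_im, him] at him'
  have ht1 : 1 < ‖t‖ := by
    have := Complex.abs_im_le_norm t
    have := le_abs_self t.im
    linarith
  refine ⟨ht1, by linarith, ?_⟩
  have h16 : ‖16 * (b : ℂ) ^ 4 * t‖ = 16 * (b : ℝ) ^ 4 * ‖t‖ := by
    have : (16 * (b : ℂ) ^ 4) = ((16 * b ^ 4 : ℝ) : ℂ) := by push_cast; rfl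
    rw [norm_mul, this, Complex.norm_real, Real.norm_of_nonneg (by positivity)]
  have h5 := norm_sub_norm_le (16 * (b : ℂ) ^ 4 * t) 5
  rw [norm_sub_rev, h16, Complex.norm_ofNat] at h5
  have : 16 * 1 ≤ (b : ℝ) ^ 4 * ‖t‖ := mul_le_mul hb4 ht1.le (by norm_num) (by positivity)
  linarith

theorem endpoint_bounds {x t : ℝ} (hx : 2 ≤ x) (ht : t ^ 2 ≤ 1 / 64) :
    (18 / 10 * x ^ 4 / (4 * x ^ 4) + 2 * (128 / 100 / (156 / 10 * x ^ 4)) * (2 * x ^ 2)⁻¹ +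
      2 * (128 / 100 / (156 / 10 * x ^ 4)) / (2 * x ^ 2)⁻¹ < 1 ∧
    18 / 10 * x ^ 4 / (4 * x ^ 4) + 2 * (128 / 100 / (156 / 10 * x ^ 4)) * (2 * x ^ 2) +
      2 * (128 / 100 / (156 / 10 * x ^ 4)) / (2 * x ^ 2) < 1) ∧
    18 / 10 * x ^ 4 / (4 * x ^ 4) * t ^ 2 +
      2 * (128 / 100 / (156 / 10 * x ^ 4)) * (143 / 100 * x) ^ 2 * (2 * x ^ 2)⁻¹ +
      2 * (128 / 100 / (156 / 10 * x ^ 4)) * (143 / 100 * x) ^ 2 / (2 * x ^ 2)⁻¹ < 1 ∧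
    18 / 10 * x ^ 4 / (4 * x ^ 4) * t ^ 2 +
      2 * (128 / 100 / (156 / 10 * x ^ 4)) * (143 / 100 * x) ^ 2 * (2 * x ^ 2) +
      2 * (128 / 100 / (156 / 10 * x ^ 4)) * (143 / 100 * x) ^ 2 / (2 * x ^ 2) < 1 := by
  have hx0 : 0 < x := by linarith
  have hx2 : 4 ≤ x ^ 2 := by nlinarith
  obtain ⟨q, hq⟩ : ∃ q, q = (x ^ 2)⁻¹ := ⟨_, rfl⟩
  have hq0 : 0 ≤ q := by rw [hq]; positivity
  have hq4 : q ≤ 1 / 4 := by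
    rw [hq, inv_le_comm₀ (by positivity) (by norm_num)]; linarith
  have hq2 := pow_le_pow_left₀ hq0 hq4 2
  have hq3 := pow_le_pow_left₀ hq0 hq4 3
  have e₀ : 18 / 10 * x ^ 4 / (4 * x ^ 4) = 45 / 100 := by field_simp; norm_num
  have e₁ : 2 * (128 / 100 / (156 / 10 * x ^ 4)) * (2 * x ^ 2)⁻¹ = 128 / 1560 * q ^ 3 := by
    rw [hq]; field_simp; norm_num
  have e₂ : 2 * (128 / 100 / (156 / 10 * x ^ 4)) * (2 * x ^ 2) = 512 / 1560 * q := by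
    rw [hq]; field_simp; norm_num
  have e₃ : 2 * (128 / 100 / (156 / 10 * x ^ 4)) * (143 / 100 * x) ^ 2 * (2 * x ^ 2)⁻¹ =
      128 / 1560 * (143 / 100) ^ 2 * q ^ 2 := by
    rw [hq]; field_simp; norm_num
  have e₄ : 2 * (128 / 100 / (156 / 10 * x ^ 4)) * (143 / 100 * x) ^ 2 * (2 * x ^ 2) =
      512 / 1560 * (143 / 100) ^ 2 := by
    field_simp; norm_num
  simp only [div_inv_eq_mul, div_eq_mul_inv _ (2 * x ^ 2), e₀, e₁, e₂, e₃, e₄]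
  refine ⟨⟨?_, ?_⟩, ?_, ?_⟩ <;> linarith

set_option maxHeartbeats 2000000 in
theorem exists_eq_zpow_of_two_le {b : ℤ} (hb : 2 ≤ b) :
    ∃ (t₀ : ℝ) (t₁ t₂ : ℂ), ThueRoots b t₀ t₁ t₂ ∧ t₀ < 1 ∧
    1 < ‖t₁‖ ∧ 1 < ‖t₁ ^ 2 + 2 * b * t₁ + 2 * b ^ 2‖ ∧
    ∀ u : (AdjoinRoot (thuePoly b))ˣ, ∃ (s : ℤˣ) (n m : ℤ), (u : AdjoinRoot (thuePoly b)) =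
      ((s : ℤ) : AdjoinRoot (thuePoly b)) *
        ((thueUnit₁ b ^ n * thueUnit₂ b ^ m : (AdjoinRoot (thuePoly b))ˣ) :
          AdjoinRoot (thuePoly b)) := by
  obtain ⟨t₀, t₁, t₂, H, h₀, h₀', h₁, h₂⟩ := exists_thueRoots_of_two_le hb
  have hb' : (2 : ℝ) ≤ b := by exact_mod_cast hb
  have hb0 : (0 : ℝ) < b := by linarith
  have hb2 : (4 : ℝ) ≤ (b : ℝ) ^ 2 := by nlinarith
  have hb4 : (16 : ℝ) ≤ (b : ℝ) ^ 4 := by nlinarith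
  obtain ⟨ht₁', ht₁, hw₁⟩ := norm_bounds_of_two_le hb (by simp) (by simp) h₁
  obtain ⟨ht₂', ht₂, hw₂⟩ := norm_bounds_of_two_le hb (by simp) (by simp) h₂
  have hq : 1 / (4 * (b : ℝ) ^ 4) ≤ 1 / 64 := by gcongr; linarith
  have hx₁' : 1 < ‖t₁ ^ 2 + 2 * b * t₁ + 2 * b ^ 2‖ := by
    have re₁ := abs_le.1 ((Complex.abs_re_le_norm _).trans h₁)
    have im₁ := abs_le.1 ((Complex.abs_im_le_norm _).trans h₁)
    simp at re₁ im₁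
    refine lt_of_lt_of_le ?_ ((le_abs_self _).trans (Complex.abs_re_le_norm _))
    have : (t₁ ^ 2 + 2 * b * t₁ + 2 * b ^ 2).re =
        t₁.re ^ 2 - t₁.im ^ 2 + 2 * b * t₁.re + 2 * b ^ 2 := by
      simp [pow_two]
    rw [this]
    nlinarith
  have hx₁ : ‖t₁ ^ 2 + 2 * b * t₁ + 2 * b ^ 2‖ ≤ 7 * (b : ℝ) ^ 2 := by
    have hn : ‖(b : ℂ)‖ = b := by rw [Complex.norm_intCast, abs_of_pos hb0]
    refine (norm_add₃_le).trans ?_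
    simp only [norm_mul, norm_pow, hn, Complex.norm_ofNat]
    nlinarith [norm_nonneg t₁, pow_le_pow_left₀ (norm_nonneg t₁) ht₁ 2]
  have hx₀ : t₀ ^ 2 + 2 * b * t₀ + 2 * b ^ 2 ≤ 3 * (b : ℝ) ^ 2 := by
    have := H.pos₀
    nlinarith
  have hlog₀ : Real.log 4 + 4 * Real.log b ≤ -Real.log t₀ := by
    have e : Real.log 4 + 4 * Real.log b = Real.log (4 * (b : ℝ) ^ 4) := by
      rw [Real.log_mul (by norm_num) (by positivity), Real.log_pow]; norm_num
    rw [← Real.log_inv, e]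
    refine Real.log_le_log (by positivity) ?_
    rw [le_inv_comm₀ (by positivity) H.pos₀, inv_eq_one_div]
    exact h₀'
  have hKl : 4495 / 10000 ≤ 18 / 10 * (b : ℝ) ^ 4 * t₀ := by
    rw [div_le_iff₀ (by positivity)] at h₀
    linarith
  have hKu : 18 / 10 * (b : ℝ) ^ 4 * t₀ ≤ 1 := by
    rw [le_div_iff₀ (by positivity)] at h₀'
    linarith
  have hlogK : -Real.log (18 / 10 * (b : ℝ) ^ 4 * t₀) ≤ Real.log (10000 / 4495) := by
    rw [← Real.log_inv]
    refine Real.log_le_log (inv_pos.2 (by linarith)) ?_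
    rw [inv_le_comm₀ (by linarith) (by norm_num)]
    linarith
  have hlt₁ := Real.log_le_log (by linarith) ht₁
  have hlt₂ := Real.log_le_log (by linarith) ht₂
  have hlx₁ := Real.log_le_log (by linarith) hx₁
  have hlx₀ := Real.log_le_log (by nlinarith [H.pos₀]) hx₀
  have hlog2 : Real.log 2 ≤ Real.log b := Real.log_le_log (by norm_num) hb'
  rw [Real.log_mul (by norm_num) (by positivity)] at hlt₁ hlt₂
  rw [Real.log_mul (by norm_num) (by positivity), Real.log_pow] at hlx₁ hlx₀
  have hlg : Real.log (2 * (b : ℝ) ^ 2) = Real.log 2 + 2 * Real.log b := by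
    rw [Real.log_mul (by norm_num) (by positivity), Real.log_pow]; norm_num
  have p₁ := mul_log_le_mul_log (x := 143 / 100) (y := 4) (k := 10) (n := 3)
    (by norm_num) (by norm_num)
  have p₂ := mul_log_le_mul_log (x := 10000 / 4495) (y := 128 / 100) (k := 3) (n := 10)
    (by norm_num) (by norm_num)
  have p₃ := mul_log_le_mul_log (x := 7 ^ 10 * 3 ^ 3) (y := 2) (k := 1) (n := 34)
    (by norm_num) (by norm_num)
  rw [Real.log_mul (by norm_num) (by norm_num), Real.log_pow, Real.log_pow] at p₃
  push_cast at p₁ p₂ p₃ hlx₀ hlx₁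
  have w₁ := norm_derivative_ge H.root₁ le_rfl (by positivity) hw₁
  have w₂ := norm_derivative_ge H.root₂ le_rfl (by positivity) hw₂
  have w₀ : 4 * (b : ℝ) ^ 4 ≤ ‖5 * (t₀ : ℂ) ^ 4 + 4 * (b : ℂ) ^ 4‖ := by
    have : 5 * (t₀ : ℂ) ^ 4 + 4 * (b : ℂ) ^ 4 = ((5 * t₀ ^ 4 + 4 * b ^ 4 : ℝ) : ℂ) := by
      push_cast; ring
    rw [this, Complex.norm_real, Real.norm_of_nonneg (by positivity)]
    linarith [pow_nonneg H.pos₀.le 4]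
  refine ⟨t₀, t₁, t₂, H, by linarith, ht₁', hx₁', ?_⟩
  have hlogb : 0 < Real.log b := Real.log_pos (by linarith)
  have ht₀ : t₀ ^ 2 ≤ 1 / 64 := by
    have := pow_le_pow_left₀ H.pos₀.le (h₀'.trans hq) 2
    linarith
  obtain ⟨⟨c₁, c₂⟩, c₃, c₄⟩ := endpoint_bounds hb' ht₀
  exact H.exists_eq_zpow_of_bounds (by linarith) (by linarith) (by linarith) (by linarith)
    ht₁' ht₂' hx₁' (K := 18 / 10 * (b : ℝ) ^ 4) (ρ₁ := 3 / 10) (ρ₂ := 3 / 10)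
    (y₀ := 1 / 2) (α := 128 / 100) (β := 128 / 100) (l := (2 * (b : ℝ) ^ 2)⁻¹)
    (g := 2 * (b : ℝ) ^ 2) (w₀ := 4 * (b : ℝ) ^ 4) (w₁ := 156 / 10 * (b : ℝ) ^ 4)
    (w₂ := 156 / 10 * (b : ℝ) ^ 4) (s₁ := (143 / 100 * (b : ℝ)) ^ 2)
    (s₂ := (143 / 100 * (b : ℝ)) ^ 2)
    (by positivity) hKu (by linarith) (by linarith) (by norm_num) (by norm_num)
    (by norm_num) (by norm_num) (by positivity) (by positivity) (by linarith) (by linarith)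
    (by rw [Real.log_inv, hlg]; linarith) (by rw [hlg]; linarith) (by positivity)
    (by positivity) (by positivity)
    w₀ w₁ w₂ (pow_le_pow_left₀ (norm_nonneg _) ht₁ 2) (pow_le_pow_left₀ (norm_nonneg _) ht₂ 2)
    c₁ c₂ c₃ c₄

theorem existsUnique_zpow_of_pos {b : ℤ} (hb : 0 < b) (u : (AdjoinRoot (thuePoly b))ˣ) :
    ∃! v : ℤˣ × ℤ × ℤ, (u : AdjoinRoot (thuePoly b)) =
      ((v.1 : ℤ) : AdjoinRoot (thuePoly b)) *
        ((thueUnit₁ b ^ v.2.1 * thueUnit₂ b ^ v.2.2 : (AdjoinRoot (thuePoly b))ˣ) :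
          AdjoinRoot (thuePoly b)) := by
  obtain ⟨t₀, t₁, t₂, h, ht₀, ht₁, hx₁, hu⟩ : ∃ (t₀ : ℝ) (t₁ t₂ : ℂ), ThueRoots b t₀ t₁ t₂ ∧
      t₀ < 1 ∧ 1 < ‖t₁‖ ∧ 1 < ‖t₁ ^ 2 + 2 * b * t₁ + 2 * b ^ 2‖ ∧
      ∀ u : (AdjoinRoot (thuePoly b))ˣ, ∃ (s : ℤˣ) (n m : ℤ),
        (u : AdjoinRoot (thuePoly b)) = ((s : ℤ) : AdjoinRoot (thuePoly b)) *
          ((thueUnit₁ b ^ n * thueUnit₂ b ^ m : (AdjoinRoot (thuePoly b))ˣ) :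
            AdjoinRoot (thuePoly b)) := by
    rcases eq_or_lt_of_le (show 1 ≤ b from hb) with rfl | hb2
    · exact exists_eq_zpow_of_eq_one
    · exact exists_eq_zpow_of_two_le hb2
  obtain ⟨s, n, m, hs⟩ := hu u
  exact ⟨(s, n, m), hs, fun w hw => h.zpow_injective hb ht₀ ht₁ hx₁ (hw.symm.trans hs)⟩

theorem thuePoly_neg (b : ℤ) : thuePoly (-b) = thuePoly b := by
  rw [thuePoly, thuePoly, (by decide : Even 4).neg_pow]

/-- The substitution of exponents induced by `ξ₂(-b) = ξ₁(b)⁻¹ * ξ₂(b)⁻¹`. -/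
theorem existsUnique_zpow_of_inv_mul_inv {R : Type*} [CommRing R] {x y z : Rˣ}
    (hz : z = x⁻¹ * y⁻¹) {u : Rˣ}
    (h : ∃! v : ℤˣ × ℤ × ℤ, (u : R) = ((v.1 : ℤ) : R) * ((x ^ v.2.1 * z ^ v.2.2 : Rˣ) : R)) :
    ∃! v : ℤˣ × ℤ × ℤ, (u : R) = ((v.1 : ℤ) : R) * ((x ^ v.2.1 * y ^ v.2.2 : Rˣ) : R) := by
  have hxy : ∀ n m : ℤ, x ^ n * y ^ m = x ^ (n - m) * z ^ (-m) := by
    intro n m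
    rw [hz, ← mul_inv, inv_zpow, zpow_neg, inv_inv, mul_zpow, ← mul_assoc, ← zpow_add,
      sub_add_cancel]
  obtain ⟨⟨s, n, m⟩, hv, huniq⟩ := h
  refine ⟨(s, n - m, -m), ?_, ?_⟩
  · simp only at hv ⊢
    rw [hv, hxy, neg_neg, sub_neg_eq_add, sub_add_cancel]
  · rintro ⟨s', n', m'⟩ hw
    simp only at hw
    rw [hxy] at hw
    have := huniq (s', n' - m', -m') hw
    simp only [Prod.mk.injEq] at this ⊢
    exact ⟨this.1, by linarith, by linarith⟩

theorem existsUnique_zpow_neg {b : ℤ}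
    (h : ∀ u : (AdjoinRoot (thuePoly (-b)))ˣ, ∃! v : ℤˣ × ℤ × ℤ,
      (u : AdjoinRoot (thuePoly (-b))) = ((v.1 : ℤ) : AdjoinRoot (thuePoly (-b))) *
        ((thueUnit₁ (-b) ^ v.2.1 * thueUnit₂ (-b) ^ v.2.2 : (AdjoinRoot (thuePoly (-b)))ˣ) :
          AdjoinRoot (thuePoly (-b)))) (u : (AdjoinRoot (thuePoly b))ˣ) :
    ∃! v : ℤˣ × ℤ × ℤ, (u : AdjoinRoot (thuePoly b)) =
      ((v.1 : ℤ) : AdjoinRoot (thuePoly b)) *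
        ((thueUnit₁ b ^ v.2.1 * thueUnit₂ b ^ v.2.2 : (AdjoinRoot (thuePoly b))ˣ) :
          AdjoinRoot (thuePoly b)) := by
  have key : ∀ p : ℤ[X], p = thuePoly b → ∀ x z : (AdjoinRoot p)ˣ,
      (x : AdjoinRoot p) = AdjoinRoot.root p →
      (z : AdjoinRoot p) = AdjoinRoot.root p ^ 2 + 2 * ((-b : ℤ) : AdjoinRoot p) *
        AdjoinRoot.root p + 2 * ((-b : ℤ) : AdjoinRoot p) ^ 2 →
      (∀ u : (AdjoinRoot p)ˣ, ∃! v : ℤˣ × ℤ × ℤ,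
        (u : AdjoinRoot p) = ((v.1 : ℤ) : AdjoinRoot p) *
          ((x ^ v.2.1 * z ^ v.2.2 : (AdjoinRoot p)ˣ) : AdjoinRoot p)) →
      ∃! v : ℤˣ × ℤ × ℤ, (u : AdjoinRoot (thuePoly b)) =
        ((v.1 : ℤ) : AdjoinRoot (thuePoly b)) *
          ((thueUnit₁ b ^ v.2.1 * thueUnit₂ b ^ v.2.2 : (AdjoinRoot (thuePoly b))ˣ) :
            AdjoinRoot (thuePoly b)) := by
    rintro p rfl x z hx hz hp
    obtain rfl : x = thueUnit₁ b := Units.ext hx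
    refine existsUnique_zpow_of_inv_mul_inv ?_ (hp u)
    rw [← mul_inv, eq_inv_iff_mul_eq_one]
    apply Units.ext
    rw [Units.val_mul, Units.val_mul, hz, coe_thueUnit₁, coe_thueUnit₂, Units.val_one]
    push_cast
    linear_combination thuePoly_aurifeuille b
  exact key _ (thuePoly_neg b) _ _ (coe_thueUnit₁ _) (coe_thueUnit₂ _) h

/-- Let `b` be a nonzero integer, `R = ℤ[X]/(X^5 + 4*b^4*X - 1)` and `θ` the class of `X`.
Then `θ` is a unit of `R` with inverse `θ^4 + 4*b^4`, the element `ξ₂ = θ^2 + 2*b*θ + 2*b^2`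
is a unit of `R`, and every unit `u` of `R` is uniquely of the form `s·ξ₁^{n₁}·ξ₂^{n₂}` with
`s ∈ {1, -1}` and `n₁, n₂ ∈ ℤ`, where `ξ₁ = θ`. -/
theorem quintic_ring_fundamental_units (b : ℤ) (hb : b ≠ 0) :
    AdjoinRoot.root (thuePoly b) *
        ((AdjoinRoot.root (thuePoly b)) ^ 4 + 4 * (b : AdjoinRoot (thuePoly b)) ^ 4) = 1 ∧
    IsUnit ((AdjoinRoot.root (thuePoly b)) ^ 2 +
        2 * (b : AdjoinRoot (thuePoly b)) * AdjoinRoot.root (thuePoly b) +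
        2 * (b : AdjoinRoot (thuePoly b)) ^ 2) ∧
    ∃ ξ₁ ξ₂ : (AdjoinRoot (thuePoly b))ˣ,
      (ξ₁ : AdjoinRoot (thuePoly b)) = AdjoinRoot.root (thuePoly b) ∧
      ((ξ₁⁻¹ : (AdjoinRoot (thuePoly b))ˣ) : AdjoinRoot (thuePoly b)) =
        (AdjoinRoot.root (thuePoly b)) ^ 4 + 4 * (b : AdjoinRoot (thuePoly b)) ^ 4 ∧
      (ξ₂ : AdjoinRoot (thuePoly b)) = (AdjoinRoot.root (thuePoly b)) ^ 2 +
        2 * (b : AdjoinRoot (thuePoly b)) * AdjoinRoot.root (thuePoly b) +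
        2 * (b : AdjoinRoot (thuePoly b)) ^ 2 ∧
      ∀ u : (AdjoinRoot (thuePoly b))ˣ, ∃! v : ℤˣ × ℤ × ℤ,
        (u : AdjoinRoot (thuePoly b)) =
          ((v.1 : ℤ) : AdjoinRoot (thuePoly b)) *
            ((ξ₁ ^ v.2.1 * ξ₂ ^ v.2.2 : (AdjoinRoot (thuePoly b))ˣ) :
              AdjoinRoot (thuePoly b)) := by
  have hex : ∀ u : (AdjoinRoot (thuePoly b))ˣ, ∃! v : ℤˣ × ℤ × ℤ,
      (u : AdjoinRoot (thuePoly b)) = ((v.1 : ℤ) : AdjoinRoot (thuePoly b)) *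
        ((thueUnit₁ b ^ v.2.1 * thueUnit₂ b ^ v.2.2 : (AdjoinRoot (thuePoly b))ˣ) :
          AdjoinRoot (thuePoly b)) := by
    rcases lt_or_gt_of_ne hb with h | h
    · exact existsUnique_zpow_neg (existsUnique_zpow_of_pos (by linarith))
    · exact existsUnique_zpow_of_pos h
  exact ⟨thuePoly_root_mul b, (thueUnit₂ b).isUnit, thueUnit₁ b, thueUnit₂ b, rfl, rfl, rfl, hex⟩
end

section
/- Let b be a nonzero integer divisible by 5, let k ≥ 1 be the 5-adic valuation of b, let R = Z[X]/(X^5 + 4*b^4*X - 1), θ the class of X in R, and let ξ_1 = θ and ξ_2 = θ^2 + 2*b*θ + 2*b^2, which are units of R. Then for all integers n_1 and n_2, the images in the quotient ring R/(5^{3k}) of ξ_1^{n_1}·ξ_2^{n_2} and of θ^{n_1 + 2*n_2 - 2} · (θ^2 + 2*n_2*b*θ + 2*n_2^2*b^2) coincide, where the (possibly negative) integer powers of the units ξ_1, ξ_2, θ are taken in the unit group. -/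
open Polynomial

/-- The quotient map `R → R/(5^{3k})`, where `R = ℤ[X]/(X^5 + 4*b^4*X - 1)`. -/
noncomputable def qmap (b : ℤ) (k : ℕ) :
    AdjoinRoot (thuePoly b) →+*
      AdjoinRoot (thuePoly b) ⧸
        Ideal.span {((5 : AdjoinRoot (thuePoly b)) ^ (3 * k))} :=
  Ideal.Quotient.mk _

/-- If `c ^ 3 = 0`, then `n ↦ 1 + 2 * n * (c / x) + 2 * n ^ 2 * (c / x) ^ 2` is multiplicative, being
the truncation of `exp (2 * n * c / x)`; this computes the powers of its value at `n = 1`, scaled by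
`x ^ 2`. -/
theorem Units.zpow_eq_of_cube_eq_zero {A : Type*} [CommRing A] (x y : Aˣ) {c : A} (hc : c ^ 3 = 0)
    (hy : (y : A) = x ^ 2 + 2 * c * x + 2 * c ^ 2) (n : ℤ) :
    ((y ^ n : Aˣ) : A) =
      ((x ^ (2 * n - 2) : Aˣ) : A) * (x ^ 2 + 2 * n * c * x + 2 * n ^ 2 * c ^ 2) := by
  have step (m : ℤ) :
      ((x ^ (2 * m - 2) : Aˣ) : A) * (x ^ 2 + 2 * m * c * x + 2 * m ^ 2 * c ^ 2) * y =
        ((x ^ (2 * (m + 1) - 2) : Aˣ) : A) *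
          (x ^ 2 + 2 * (m + 1 : ℤ) * c * x + 2 * (m + 1 : ℤ) ^ 2 * c ^ 2) := by
    have hx : x ^ (2 * (m + 1) - 2) = x ^ (2 * m - 2) * x ^ 2 := by
      rw [← zpow_natCast, ← zpow_add]
      congr 1
      push_cast
      ring
    rw [hx, hy]
    push_cast
    linear_combination ((x ^ (2 * m - 2) : Aˣ) : A) *
      (4 * m * x + 4 * m ^ 2 * x + 4 * m ^ 2 * c) * hc
  induction n using Int.induction_on with
  | zero => simp [← mul_pow]
  | succ m ih => rw [zpow_add_one, Units.val_mul, ih, step]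
  | pred m ih =>
    rw [← Units.mul_left_inj y, ← Units.val_mul, ← zpow_add_one, step, sub_add_cancel, ih]

/-- Let `b` be a nonzero integer divisible by 5, `k ≥ 1` the 5-adic valuation of `b`,
`R = ℤ[X]/(X^5 + 4*b^4*X - 1)`, `θ` the class of `X`, and `ξ₁ = θ`,
`ξ₂ = θ^2 + 2*b*θ + 2*b^2` the corresponding units of `R`. Then for all integers `n₁, n₂`,
the images in `R/(5^{3k})` of `ξ₁^{n₁}·ξ₂^{n₂}` and of
`θ^{n₁+2n₂-2}·(θ^2 + 2n₂*b*θ + 2n₂^2*b^2)` coincide. -/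
theorem quintic_unit_power_congruence (b : ℤ) (hb : b ≠ 0) (hb5 : (5 : ℤ) ∣ b)
    (k : ℕ) (hk : k = padicValInt 5 b) (hk1 : 1 ≤ k)
    (ξ₁ ξ₂ : (AdjoinRoot (thuePoly b))ˣ)
    (hξ₁ : (ξ₁ : AdjoinRoot (thuePoly b)) = AdjoinRoot.root (thuePoly b))
    (hξ₂ : (ξ₂ : AdjoinRoot (thuePoly b)) = (AdjoinRoot.root (thuePoly b)) ^ 2 +
      2 * (b : AdjoinRoot (thuePoly b)) * AdjoinRoot.root (thuePoly b) +
      2 * (b : AdjoinRoot (thuePoly b)) ^ 2) :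
    ∀ n₁ n₂ : ℤ,
      ((Units.map (qmap b k).toMonoidHom ξ₁ ^ n₁ *
          Units.map (qmap b k).toMonoidHom ξ₂ ^ n₂) :
        (AdjoinRoot (thuePoly b) ⧸
          Ideal.span {((5 : AdjoinRoot (thuePoly b)) ^ (3 * k))})ˣ) =
      ((Units.map (qmap b k).toMonoidHom ξ₁ ^ (n₁ + 2 * n₂ - 2) :
          (AdjoinRoot (thuePoly b) ⧸
            Ideal.span {((5 : AdjoinRoot (thuePoly b)) ^ (3 * k))})ˣ) :
        AdjoinRoot (thuePoly b) ⧸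
          Ideal.span {((5 : AdjoinRoot (thuePoly b)) ^ (3 * k))}) *
        qmap b k ((AdjoinRoot.root (thuePoly b)) ^ 2 +
          2 * (n₂ : AdjoinRoot (thuePoly b)) * (b : AdjoinRoot (thuePoly b)) *
            AdjoinRoot.root (thuePoly b) +
          2 * (n₂ : AdjoinRoot (thuePoly b)) ^ 2 * (b : AdjoinRoot (thuePoly b)) ^ 2) := by
  intro n₁ n₂
  have h5 : (5 : AdjoinRoot (thuePoly b)) ^ (3 * k) ∣ (b : AdjoinRoot (thuePoly b)) ^ 3 := by
    have h : (5 : ℤ) ^ k ∣ b := hk ▸ padicValInt_dvd (p := 5) b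
    have h' := map_dvd (Int.castRingHom (AdjoinRoot (thuePoly b))) (pow_dvd_pow_of_dvd h 3)
    rw [← pow_mul, mul_comm k 3] at h'
    simpa using h'
  have hc : qmap b k (b : AdjoinRoot (thuePoly b)) ^ 3 = 0 := by
    rw [← map_pow]
    exact Ideal.Quotient.eq_zero_iff_mem.mpr (Ideal.mem_span_singleton.mpr h5)
  have h2 : qmap b k 2 = 2 := map_ofNat _ 2
  have hx : ((Units.map (qmap b k).toMonoidHom ξ₁ : Units _) : _ ⧸ _) =
      qmap b k (AdjoinRoot.root (thuePoly b)) := congrArg (qmap b k) hξ₁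
  have hy : ((Units.map (qmap b k).toMonoidHom ξ₂ : Units _) : _ ⧸ _) =
      qmap b k _ := congrArg (qmap b k) hξ₂
  have key := Units.zpow_eq_of_cube_eq_zero (Units.map (qmap b k).toMonoidHom ξ₁)
    (Units.map (qmap b k).toMonoidHom ξ₂) hc (by rw [hy, hx]; simp [h2]) n₂
  rw [Units.val_mul, key, ← mul_assoc, ← Units.val_mul, ← zpow_add, ← add_sub_assoc, hx]
  simp [h2]
end
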